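/- arXiv:2005.09462 — 2 statements merged into one kernel-verified Lean document; each statement's English description precedes it below -/
import Mathlib

section
/- Let g : ℕ → ℝ be nonnegative and nonincreasing, S = (r; m_2,...,m_l) a tree eccentric sequence, and T(r;m_2,...,m_l) the standard caterpillar obtained from a path v_0,...,v_{r+l-1} by attaching m_j - 2 pendent edges to v_{l+1-j} for 2 ≤ j ≤ l. Then for every tree T with eccentric sequence S, W(T; g) ≤ W(T(r;m_2,...,m_l); g), with equality (when g is strictly decreasing) if and only if T ≅ T(r;m_2,...,m_l). -/
open SimpleGraph Finset

attribute [local instance] Classical.propDecidable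

variable {V : Type*}

/-- The eccentricity of a vertex: the maximum distance to any other vertex. -/
noncomputable def ecc [Fintype V] (G : SimpleGraph V) (v : V) : ℕ :=
  Finset.univ.sup fun u => G.dist v u

/-- The diameter: the maximum eccentricity. -/
noncomputable def graphDiam [Fintype V] (G : SimpleGraph V) : ℕ :=
  Finset.univ.sup fun v => ecc G v

/-- The radius: the minimum eccentricity. -/
noncomputable def graphRad [Fintype V] [Nonempty V] (G : SimpleGraph V) : ℕ :=
  Finset.univ.inf' Finset.univ_nonempty fun v => ecc G v

/-- The Wiener-type index `W(G;g)`: sum of `g (d(u,v))` over unordered pairs of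
distinct vertices (here realised as half of the sum over ordered pairs). -/
noncomputable def wiener [Fintype V] (G : SimpleGraph V) (g : ℕ → ℝ) : ℝ :=
  (∑ p ∈ Finset.univ.offDiag, g (G.dist p.1 p.2)) / 2

/-- Steiner distance of a set `A`: minimum number of edges of a subtree whose
vertex set contains `A` (in a tree, a connected subgraph on `m+1` vertices has `m` edges). -/
noncomputable def steinerDist [Fintype V] (G : SimpleGraph V) (A : Finset V) : ℕ :=
  sInf {m | ∃ S : Finset V, A ⊆ S ∧ (G.induce (S : Set V)).Connected ∧ S.card = m + 1}

/-- The `k`-Steiner Wiener index. -/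
noncomputable def steinerWiener [Fintype V] (G : SimpleGraph V) (k : ℕ) : ℕ :=
  ∑ A ∈ Finset.univ.powersetCard k, steinerDist G A

/-- A leaf (pendent vertex): a vertex of degree 1. -/
def IsLeaf (G : SimpleGraph V) (v : V) : Prop :=
  Nat.card {u : V // G.Adj v u} = 1

/-- A caterpillar: a tree in which deleting all leaves yields a path;
equivalently (for trees) every non-leaf vertex has at most two non-leaf neighbours. -/
def IsCaterpillar (G : SimpleGraph V) : Prop :=
  ∀ v : V, ¬ IsLeaf G v → Nat.card {u : V // G.Adj v u ∧ ¬ IsLeaf G u} ≤ 2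

/-- Two graphs have the same eccentric sequence. -/
def sameEccSeq {W : Type*} [Fintype V] [Fintype W]
    (G : SimpleGraph V) (H : SimpleGraph W) : Prop :=
  ∀ k : ℕ, Nat.card {v : V // ecc G v = k} = Nat.card {w : W // ecc H w = k}

/-- Vertex type of the standard caterpillar `T(r; m₂,…,m_l)`: the path
`v_0,…,v_{r+l-1}` together with `m_j - 2` pendent vertices attached at `v_{l+1-j}`
for each `2 ≤ j ≤ l` (indexed by `i = j - 2`). -/
abbrev StdVert (r l : ℕ) (m : ℕ → ℕ) : Type :=
  Fin (r + l) ⊕ ((i : Fin (l - 1)) × Fin (m (i.1 + 2) - 2))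

/-- Base relation of the standard caterpillar: consecutive path vertices are adjacent,
and each pendent vertex with index `i` (i.e. `j = i + 2`) is adjacent to `v_{l-1-i} = v_{l+1-j}`. -/
def stdRel (r l : ℕ) (m : ℕ → ℕ) : StdVert r l m → StdVert r l m → Prop
  | Sum.inl a, Sum.inl b => (a : ℕ) + 1 = (b : ℕ)
  | Sum.inr ⟨i, _⟩, Sum.inl a => (a : ℕ) = l - 1 - (i : ℕ)
  | _, _ => False

/-- The standard caterpillar `T(r; m₂,…,m_l)`. -/
def stdCat (r l : ℕ) (m : ℕ → ℕ) : SimpleGraph (StdVert r l m) :=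
  SimpleGraph.fromRel (stdRel r l m)

section TreeMetric

variable {G : SimpleGraph V}

lemma SimpleGraph.Connected.exists_adj_dist_eq (hG : G.Connected) {x y : V} {n : ℕ}
    (h : G.dist x y = n + 1) : ∃ x', G.Adj x x' ∧ G.dist x' y = n := by
  obtain ⟨p, hp⟩ := hG.exists_walk_length_eq_dist x y
  cases p with
  | nil => simp at h
  | @cons _ x' _ hadj q =>
    refine ⟨x', hadj, ?_⟩
    have h1 := G.dist_le q
    have h2 := hG.dist_triangle (u := x) (v := x') (w := y)
    have h3 := dist_eq_one_iff_adj.2 hadj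
    simp only [Walk.length_cons] at hp
    omega

lemma SimpleGraph.IsTree.dist_adj_cases (hG : G.IsTree) {x y : V} (h : G.Adj x y) (z : V) :
    G.dist z x = G.dist z y + 1 ∨ G.dist z y = G.dist z x + 1 := by
  have h1 := hG.dist_ne_of_adj z h
  have h2 := hG.connected.dist_triangle (u := z) (v := x) (w := y)
  have h3 := hG.connected.dist_triangle (u := z) (v := y) (w := x)
  have h4 := dist_eq_one_iff_adj.2 h
  have h5 := dist_eq_one_iff_adj.2 h.symm
  omega

/-- In a tree, at most one neighbour of a vertex is closer to a given vertex. -/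
lemma SimpleGraph.IsTree.eq_of_adj_of_dist_lt (hG : G.IsTree) {v p q z : V}
    (hp : G.Adj v p) (hq : G.Adj v q) (hpz : G.dist z p < G.dist z v)
    (hqz : G.dist z q < G.dist z v) : p = q := by
  obtain ⟨P, hP⟩ := hG.connected.exists_walk_length_eq_dist p z
  obtain ⟨Q, hQ⟩ := hG.connected.exists_walk_length_eq_dist q z
  have hp' := hG.dist_adj_cases hp z
  have hq' := hG.dist_adj_cases hq z
  have h1 : (Walk.cons hp P).IsPath := by
    apply Walk.isPath_of_length_eq_dist
    rw [Walk.length_cons, hP, G.dist_comm, G.dist_comm (u := v)]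
    omega
  have h2 : (Walk.cons hq Q).IsPath := by
    apply Walk.isPath_of_length_eq_dist
    rw [Walk.length_cons, hQ, G.dist_comm, G.dist_comm (u := v)]
    omega
  have h3 := (hG.isAcyclic.subsingleton_path v z).elim ⟨_, h1⟩ ⟨_, h2⟩
  simp only [Subtype.mk.injEq, Walk.cons.injEq] at h3
  exact h3.1

/-- A geodesic in a tree that starts by moving away from `z` keeps moving away from `z`. -/
lemma SimpleGraph.IsTree.dist_eq_add_of_step_away (hG : G.IsTree) {z y : V} (n : ℕ) :
    ∀ {x x' : V}, G.Adj x x' → G.dist z x' = G.dist z x + 1 → G.dist x y = n + 1 →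
      G.dist x' y = n → G.dist z y = G.dist z x + (n + 1) := by
  induction n with
  | zero =>
    intro x x' _ h1 _ h3
    rw [(hG.connected.dist_eq_zero_iff).1 h3] at h1
    omega
  | succ n ih =>
    intro x x' h h1 h2 h3
    obtain ⟨x'', h4, h5⟩ := hG.connected.exists_adj_dist_eq h3
    have h6 : G.dist z x'' = G.dist z x' + 1 := by
      rcases hG.dist_adj_cases h4 z with h7 | h7
      · have := hG.eq_of_adj_of_dist_lt h.symm h4 (z := z) (by omega) (by omega)
        subst this
        omega
      · exact h7
    have := ih h4 h6 h3 h5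
    omega

/-- The four-point condition for trees. -/
lemma SimpleGraph.IsTree.four_point (hG : G.IsTree) (v z : V) {x y : V} :
    G.dist v z + G.dist x y ≤
      max (G.dist v x + G.dist z y) (G.dist v y + G.dist z x) := by
  induction hn : G.dist x y generalizing x with
  | zero =>
    have := hG.connected.dist_triangle (u := v) (v := x) (w := z)
    rw [G.dist_comm (u := x) (v := z)] at this
    rw [(hG.connected.dist_eq_zero_iff).1 hn] at this ⊢
    omega
  | succ n ih =>
    obtain ⟨x', h1, h2⟩ := hG.connected.exists_adj_dist_eq hn
    have h3 := ih h2
    have h4 := hG.connected.dist_triangle (u := v) (v := x) (w := z)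
    rw [G.dist_comm (u := x) (v := z)] at h4
    rcases hG.dist_adj_cases h1 v with h5 | h5
    · rcases hG.dist_adj_cases h1 z with h6 | h6
      · omega
      · have := hG.dist_eq_add_of_step_away n h1 h6 hn h2
        omega
    · have := hG.dist_eq_add_of_step_away n h1 h5 hn h2
      omega

end TreeMetric

section Eccentricity

variable [Fintype V] {G : SimpleGraph V}

lemma dist_le_ecc (u v : V) : G.dist u v ≤ ecc G u :=
  Finset.le_sup (f := fun u' => G.dist u u') (Finset.mem_univ v)

lemma exists_dist_eq_ecc (v : V) : ∃ u, G.dist v u = ecc G v := by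
  obtain ⟨u, -, hu⟩ := Finset.exists_mem_eq_sup Finset.univ ⟨v, Finset.mem_univ v⟩
    (fun u => G.dist v u)
  exact ⟨u, hu.symm⟩

lemma ecc_le_ecc_add_dist (hG : G.Connected) (u v : V) : ecc G u ≤ ecc G v + G.dist u v := by
  obtain ⟨z, hz⟩ := exists_dist_eq_ecc (G := G) u
  have h1 := dist_le_ecc (G := G) v z
  have h2 := hG.dist_triangle (u := u) (v := v) (w := z)
  omega

/-- In a tree, at most one neighbour of a vertex has no larger eccentricity. -/
lemma SimpleGraph.IsTree.eq_of_adj_of_ecc_le (hG : G.IsTree) {v p q : V}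
    (hp : G.Adj v p) (hq : G.Adj v q) (hpe : ecc G p ≤ ecc G v) (hqe : ecc G q ≤ ecc G v) :
    p = q := by
  obtain ⟨z, hz⟩ := exists_dist_eq_ecc (G := G) v
  have h1 := dist_le_ecc (G := G) p z
  have h2 := dist_le_ecc (G := G) q z
  rw [G.dist_comm] at h1 h2 hz
  have h3 := hG.dist_adj_cases hp z
  have h4 := hG.dist_adj_cases hq z
  exact hG.eq_of_adj_of_dist_lt hp hq (z := z) (by omega) (by omega)

/-- The ancestor of `v` at a given level of eccentricity is unique. -/
lemma SimpleGraph.IsTree.eq_of_dist_add_ecc_eq (hG : G.IsTree) {a : ℕ} {u₁ u₂ : V} (n : ℕ) :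
    ∀ {v : V}, ecc G v = a + n → ecc G u₁ = a → ecc G u₂ = a →
      G.dist v u₁ = n → G.dist v u₂ = n → u₁ = u₂ := by
  induction n with
  | zero =>
    intro v _ _ _ h1 h2
    rw [← (hG.connected.dist_eq_zero_iff).1 h1, (hG.connected.dist_eq_zero_iff).1 h2]
  | succ n ih =>
    intro v hv h1 h2 h3 h4
    obtain ⟨x, hx, hx'⟩ := hG.connected.exists_adj_dist_eq h3
    obtain ⟨y, hy, hy'⟩ := hG.connected.exists_adj_dist_eq h4
    have hxe := ecc_le_ecc_add_dist hG.connected x u₁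
    have hye := ecc_le_ecc_add_dist hG.connected y u₂
    obtain rfl := hG.eq_of_adj_of_ecc_le hx hy (by omega) (by omega)
    have hve := ecc_le_ecc_add_dist hG.connected v x
    rw [dist_eq_one_iff_adj.2 hx] at hve
    exact ih (by omega) h1 h2 hx' hy'

/-- Distances of the wrong parity only occur across a central edge. -/
lemma SimpleGraph.IsTree.two_mul_ecc_le_of_dist_eq (hG : G.IsTree) {D : ℕ}
    (hD : ∀ u v, G.dist u v ≤ D) {u : V} (n : ℕ) :
    ∀ {v : V}, ecc G v = ecc G u + n → G.dist v u = n + 1 → 2 * ecc G u ≤ D + 1 := by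
  induction n with
  | zero =>
    intro v hv hd
    obtain ⟨x, hx⟩ := exists_dist_eq_ecc (G := G) u
    obtain ⟨y, hy⟩ := exists_dist_eq_ecc (G := G) v
    have h1 := dist_le_ecc (G := G) v x
    have h2 := dist_le_ecc (G := G) u y
    have hadj : G.Adj v u := dist_eq_one_iff_adj.1 hd
    have h3 := hG.dist_adj_cases hadj x
    have h4 := hG.dist_adj_cases hadj y
    have h5 := hG.four_point u x (x := v) (y := y)
    have h6 := hD x y
    have h7 := hG.four_point u x (x := y) (y := v)
    have h8 := dist_eq_one_iff_adj.2 hadj.symm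
    simp only [G.dist_comm (u := x) (v := u), G.dist_comm (u := x) (v := v),
      G.dist_comm (u := y) (v := u), G.dist_comm (u := y) (v := v)] at *
    omega
  | succ n ih =>
    intro v hv hd
    obtain ⟨x, hx, hx'⟩ := hG.connected.exists_adj_dist_eq hd
    obtain ⟨y, hy, hy'⟩ := hG.connected.exists_adj_dist_eq hx'
    have h1 := ecc_le_ecc_add_dist hG.connected x u
    have h2 := ecc_le_ecc_add_dist hG.connected y u
    have h3 := ecc_le_ecc_add_dist hG.connected v x
    rw [dist_eq_one_iff_adj.2 hx] at h3
    rcases (show ecc G x = ecc G u + n ∨ ecc G x = ecc G v by omega) with h4 | h4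
    · exact ih h4 hx'
    · have := hG.eq_of_adj_of_ecc_le hx.symm hy (by omega) (by omega)
      subst this
      omega

end Eccentricity

section DiametralPath

/-- `w 0, …, w D` is a path realising the diameter `D` of `G`. -/
structure IsDiametralPath (G : SimpleGraph V) (D : ℕ) (w : ℕ → V) : Prop where
  adj : ∀ i < D, G.Adj (w i) (w (i + 1))
  dist_ends : G.dist (w 0) (w D) = D
  dist_le : ∀ u v, G.dist u v ≤ D

lemma exists_isDiametralPath {G : SimpleGraph V} (hG : G.Connected) {D : ℕ}
    (hD : ∀ u v, G.dist u v ≤ D) {x y : V} (hxy : G.dist x y = D) :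
    ∃ w : ℕ → V, IsDiametralPath G D w := by
  obtain ⟨p, hp⟩ := hG.exists_walk_length_eq_dist x y
  refine ⟨p.getVert, fun i hi => p.adj_getVert_succ (by omega), ?_, hD⟩
  rw [p.getVert_zero, show D = p.length by omega, p.getVert_length]
  omega

namespace IsDiametralPath

variable {G : SimpleGraph V} {D : ℕ} {w : ℕ → V}

lemma reverse (hw : IsDiametralPath G D w) : IsDiametralPath G D (fun i => w (D - i)) where
  adj i hi := by
    have := (hw.adj (D - (i + 1)) (by omega)).symm
    rwa [show D - (i + 1) + 1 = D - i by omega] at this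
  dist_ends := by
    rw [Nat.sub_zero, Nat.sub_self, G.dist_comm]
    exact hw.dist_ends
  dist_le := hw.dist_le

lemma dist_add_le (hG : G.Connected) (hw : IsDiametralPath G D w) (i : ℕ) :
    ∀ n, i + n ≤ D → G.dist (w i) (w (i + n)) ≤ n
  | 0, _ => by simp
  | n + 1, h => by
    have h1 := dist_add_le hG hw i n (by omega)
    have h2 := hG.dist_triangle (u := w i) (v := w (i + n)) (w := w (i + n + 1))
    have h3 := dist_eq_one_iff_adj.2 (hw.adj (i + n) (by omega))
    rw [← add_assoc]
    omega

lemma dist_left (hG : G.Connected) (hw : IsDiametralPath G D w) {i : ℕ} (hi : i ≤ D) :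
    G.dist (w i) (w 0) = i := by
  have h1 := hw.dist_add_le hG 0 i (by omega)
  have h2 := hw.dist_add_le hG i (D - i) (by omega)
  have h3 := hG.dist_triangle (u := w 0) (v := w i) (w := w D)
  have h4 := hw.dist_ends
  rw [show i + (D - i) = D by omega] at h2
  rw [zero_add] at h1
  rw [G.dist_comm]
  omega

lemma dist_right (hG : G.Connected) (hw : IsDiametralPath G D w) {i : ℕ} (hi : i ≤ D) :
    G.dist (w i) (w D) = D - i := by
  have := hw.reverse.dist_left hG (i := D - i) (by omega)
  simpa [Nat.sub_sub_self hi] using this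

lemma eq_of_apply_eq (hG : G.Connected) (hw : IsDiametralPath G D w) {i j : ℕ}
    (hi : i ≤ D) (hj : j ≤ D) (h : w i = w j) : i = j := by
  rw [← hw.dist_left hG hi, h, hw.dist_left hG hj]

variable [Fintype V]

lemma ecc_eq (hG : G.IsTree) (hw : IsDiametralPath G D w) (v : V) :
    ecc G v = max (G.dist v (w 0)) (G.dist v (w D)) := by
  apply le_antisymm
  · obtain ⟨z, hz⟩ := exists_dist_eq_ecc (G := G) v
    have h1 := hG.four_point v z (x := w 0) (y := w D)
    have h2 := hw.dist_le z (w 0)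
    have h3 := hw.dist_le z (w D)
    have h4 := hw.dist_ends
    omega
  · exact max_le (dist_le_ecc _ _) (dist_le_ecc _ _)

lemma ecc_apply (hG : G.IsTree) (hw : IsDiametralPath G D w) {i : ℕ} (hi : i ≤ D) :
    ecc G (w i) = max i (D - i) := by
  rw [hw.ecc_eq hG, hw.dist_left hG.connected hi, hw.dist_right hG.connected hi]

lemma ecc_le (hw : IsDiametralPath G D w) (v : V) : ecc G v ≤ D :=
  Finset.sup_le fun u _ => hw.dist_le v u

/-- A vertex of the diametral path of eccentricity `a`, on the other side of the centre
than `v`. -/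
noncomputable def opp (G : SimpleGraph V) (D : ℕ) (w : ℕ → V) (a : ℕ) (v : V) : V :=
  if G.dist v (w D) = ecc G v then w a else w (D - a)

lemma ecc_opp (hG : G.IsTree) (hw : IsDiametralPath G D w) {a : ℕ} (h1 : D ≤ 2 * a)
    (h2 : a ≤ D) (v : V) : ecc G (opp G D w a v) = a := by
  unfold opp
  split_ifs
  · rw [hw.ecc_apply hG h2]
    omega
  · rw [hw.ecc_apply hG (by omega)]
    omega

lemma ecc_add_le_dist_opp (hG : G.IsTree) (hw : IsDiametralPath G D w) {a : ℕ}
    (h2 : a ≤ D) (v : V) : ecc G v + a ≤ D + G.dist (opp G D w a v) v := by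
  unfold opp
  have h := hw.ecc_eq hG v
  split_ifs with h3
  · have h4 := hw.dist_right hG.connected h2
    have h5 := hG.connected.dist_triangle (u := v) (v := w a) (w := w D)
    rw [G.dist_comm]
    omega
  · have h4 := hw.dist_left hG.connected (i := D - a) (by omega)
    have h5 := hG.connected.dist_triangle (u := v) (v := w (D - a)) (w := w 0)
    rw [G.dist_comm]
    omega

lemma opp_right (hG : G.IsTree) (hw : IsDiametralPath G D w) {a b : ℕ} (h1 : D < 2 * b)
    (h2 : b ≤ D) : opp G D w a (w b) = w (D - a) := by
  unfold opp
  rw [if_neg]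
  rw [hw.dist_right hG.connected h2, hw.ecc_apply hG h2]
  omega

lemma opp_left (hG : G.IsTree) (hw : IsDiametralPath G D w) {a b : ℕ} (h1 : D < 2 * b)
    (h2 : b ≤ D) : opp G D w a (w (D - b)) = w a := by
  unfold opp
  rw [if_pos]
  rw [hw.dist_right hG.connected (by omega), hw.ecc_apply hG (by omega)]
  omega

end IsDiametralPath

end DiametralPath

section LevelSums

/-- The vertices of eccentricity `a`. -/
noncomputable def level [Fintype V] (G : SimpleGraph V) (a : ℕ) : Finset V :=
  Finset.univ.filter fun v => ecc G v = a

/-- The contribution of the pairs with eccentricities `a` and `b` to the Wiener-type index. -/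
noncomputable def levelSum [Fintype V] (G : SimpleGraph V) (g : ℕ → ℝ) (a b : ℕ) : ℝ :=
  ∑ p ∈ level G a ×ˢ level G b, g (G.dist p.1 p.2)

/-- The extremal value of `levelSum` for trees of diameter `D` with `x` and `y` vertices of
eccentricity `a` and `b`, where `a ≤ b` is not the radius. -/
noncomputable def levelBound (g : ℕ → ℝ) (D a b : ℕ) (x y : ℝ) : ℝ :=
  x * y * g (b - a + 2) + y * (g (b - a) - g (b - a + 2)) +
    (x + y - 2) * (g (a + b - D) - g (b - a + 2))

/-- The extremal value of `levelSum` when the first eccentricity is the radius. -/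
noncomputable def centralBound (g : ℕ → ℝ) (a b : ℕ) (x y : ℝ) : ℝ :=
  x * y * g (b - a + 1) + y * (g (b - a) - g (b - a + 1))

variable [Fintype V] {G : SimpleGraph V}

@[simp]
lemma mem_level {a : ℕ} {v : V} : v ∈ level G a ↔ ecc G v = a := by
  simp [level]

lemma levelSum_comm (g : ℕ → ℝ) (a b : ℕ) : levelSum G g a b = levelSum G g b a := by
  unfold levelSum
  rw [Finset.sum_product, Finset.sum_product_right]
  simp only [G.dist_comm]

lemma two_mul_wiener_add {D : ℕ} (hD : ∀ v, ecc G v ≤ D) (g : ℕ → ℝ) :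
    2 * wiener G g + Fintype.card V * g 0 =
      ∑ a ∈ range (D + 1), ∑ b ∈ range (D + 1), levelSum G g a b := by
  have hmem : ∀ v ∈ (Finset.univ : Finset V), ecc G v ∈ range (D + 1) := fun v _ =>
    Finset.mem_range.2 (Nat.lt_succ_of_le (hD v))
  have h1 : ∑ p ∈ (Finset.univ : Finset V) ×ˢ (Finset.univ : Finset V), g (G.dist p.1 p.2) =
      ∑ a ∈ range (D + 1), ∑ b ∈ range (D + 1), levelSum G g a b := by
    rw [Finset.sum_product, ← Finset.sum_fiberwise_of_maps_to hmem
      (fun u => ∑ v, g (G.dist u v))]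
    refine Finset.sum_congr rfl fun a _ => ?_
    simp only [levelSum, Finset.sum_product]
    conv_rhs => rw [Finset.sum_comm]
    refine Finset.sum_congr rfl fun u _ => ?_
    rw [← Finset.sum_fiberwise_of_maps_to hmem (fun v => g (G.dist u v))]
    rfl
  rw [← h1, ← Finset.diag_union_offDiag, Finset.sum_union (Finset.disjoint_diag_offDiag _),
    Finset.sum_diag]
  simp [wiener]
  ring

/-- The pairs of vertices that are guaranteed to be separated by the centre. -/
def Crossing (G : SimpleGraph V) (D : ℕ) (w : ℕ → V) (u v : V) : Prop :=
  u = IsDiametralPath.opp G D w (ecc G u) v ∨ v = IsDiametralPath.opp G D w (ecc G v) u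

namespace IsDiametralPath

variable {D : ℕ} {w : ℕ → V}

lemma ecc_add_ecc_le_of_crossing (hG : G.IsTree) (hw : IsDiametralPath G D w) {u v : V}
    (h : Crossing G D w u v) : ecc G u + ecc G v ≤ D + G.dist u v := by
  rcases h with h | h
  · have := hw.ecc_add_le_dist_opp hG (hw.ecc_le u) v
    rw [← h] at this
    omega
  · have := hw.ecc_add_le_dist_opp hG (hw.ecc_le v) u
    rw [← h, G.dist_comm] at this
    omega

lemma card_add_card_le (hG : G.IsTree) (hw : IsDiametralPath G D w) {a b : ℕ}
    (ha : D < 2 * a) (hb : D < 2 * b) (ha' : a ≤ D) (hb' : b ≤ D) :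
    (level G a).card + (level G b).card ≤
      ((level G a ×ˢ level G b).filter fun p => Crossing G D w p.1 p.2).card + 2 := by
  set A := (level G b).image fun v => (opp G D w a v, v)
  set B := (level G a).image fun u => (u, opp G D w b u)
  have hA : A.card = (level G b).card :=
    Finset.card_image_of_injective _ fun _ _ h => (Prod.ext_iff.1 h).2
  have hB : B.card = (level G a).card :=
    Finset.card_image_of_injective _ fun _ _ h => (Prod.ext_iff.1 h).1
  have hunion : A ∪ B ⊆
      (level G a ×ˢ level G b).filter fun p => Crossing G D w p.1 p.2 := by
    intro p hp
    rw [Finset.mem_filter, Finset.mem_product, mem_level, mem_level]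
    rcases Finset.mem_union.1 hp with hp | hp
    · obtain ⟨v, hv, rfl⟩ := Finset.mem_image.1 hp
      have h := hw.ecc_opp hG ha.le ha' v
      exact ⟨⟨h, mem_level.1 hv⟩, Or.inl (by rw [h])⟩
    · obtain ⟨u, hu, rfl⟩ := Finset.mem_image.1 hp
      have h := hw.ecc_opp hG hb.le hb' u
      exact ⟨⟨mem_level.1 hu, h⟩, Or.inr (by rw [h])⟩
  have hinter : A ∩ B ⊆ {(w a, w (D - b)), (w (D - a), w b)} := by
    intro p hp
    obtain ⟨h1, h2⟩ := Finset.mem_inter.1 hp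
    obtain ⟨v, hv, rfl⟩ := Finset.mem_image.1 h1
    obtain ⟨u, hu, h3⟩ := Finset.mem_image.1 h2
    obtain ⟨rfl, h4⟩ := Prod.ext_iff.1 h3
    simp only at h4
    have h5 : v = w b ∨ v = w (D - b) := by
      rw [← h4]
      unfold opp
      split_ifs <;> simp
    rcases h5 with rfl | rfl
    · simp [hw.opp_right hG hb hb']
    · simp [hw.opp_left hG hb hb']
  have h1 := Finset.card_le_card hunion
  have h2 := Finset.card_le_card hinter
  have h3 := Finset.card_union_add_card_inter A B
  have h4 := Finset.card_le_two (a := (w a, w (D - b))) (b := (w (D - a), w b))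
  omega

end IsDiametralPath

/-- The pairs of levels `a`, `b` in which the first vertex is an ancestor of the second. -/
lemma SimpleGraph.IsTree.card_ancestor_pairs_le (hG : G.IsTree) {a b : ℕ} (hab : a ≤ b) :
    ((level G a ×ˢ level G b).filter fun p => G.dist p.1 p.2 = b - a).card ≤
      (level G b).card := by
  apply Finset.card_le_card_of_injOn Prod.snd
  · intro p hp
    simp only [Finset.coe_filter, Finset.mem_product, Set.mem_ofPred_eq] at hp
    exact hp.1.2
  · intro p hp q hq hpq
    simp only [Finset.coe_filter, Finset.mem_product, mem_level, Set.mem_ofPred_eq] at hp hq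
    refine Prod.ext (hG.eq_of_dist_add_ecc_eq (b - a) (v := p.2) (by omega) hp.1.1 hq.1.1
      ?_ ?_) hpq
    · rw [G.dist_comm, hp.2]
    · rw [hpq, G.dist_comm, hq.2]

lemma levelSum_le_centralBound (hG : G.IsTree) {g : ℕ → ℝ} (hg : Antitone g) {a b : ℕ}
    (hab : a ≤ b) :
    levelSum G g a b ≤ centralBound g a b (level G a).card (level G b).card := by
  have h1 : levelSum G g a b ≤ ∑ p ∈ level G a ×ˢ level G b,
      (g (b - a + 1) + if G.dist p.1 p.2 = b - a then g (b - a) - g (b - a + 1) else 0) := by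
    refine Finset.sum_le_sum fun p hp => ?_
    rw [Finset.mem_product, mem_level, mem_level] at hp
    split_ifs with h
    · simp [h]
    · have := ecc_le_ecc_add_dist hG.connected p.2 p.1
      rw [G.dist_comm] at this
      rw [add_zero]
      exact hg (by omega)
  refine h1.trans ?_
  have h2 : g (b - a + 1) ≤ g (b - a) := hg (by omega)
  have h3 : (((level G a ×ˢ level G b).filter fun p => G.dist p.1 p.2 = b - a).card : ℝ) ≤
      (level G b).card := mod_cast hG.card_ancestor_pairs_le hab
  rw [Finset.sum_add_distrib, ← Finset.sum_filter, Finset.sum_const, Finset.sum_const,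
    Finset.card_product]
  simp only [nsmul_eq_mul, Nat.cast_mul, centralBound]
  gcongr

/-- The pointwise version of the bound `levelBound`. -/
noncomputable def pairBound (G : SimpleGraph V) (g : ℕ → ℝ) (D : ℕ) (w : ℕ → V) (a b : ℕ)
    (p : V × V) : ℝ :=
  g (b - a + 2) + (if G.dist p.1 p.2 = b - a then g (b - a) - g (b - a + 2) else 0) +
    (if Crossing G D w p.1 p.2 then g (a + b - D) - g (b - a + 2) else 0)

namespace IsDiametralPath

variable {D : ℕ} {w : ℕ → V}

lemma not_dist_eq_of_crossing (hG : G.IsTree) (hw : IsDiametralPath G D w) {a b : ℕ}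
    (ha : D + 2 ≤ 2 * a) (hab : a ≤ b) {p : V × V}
    (hp : p ∈ level G a ×ˢ level G b) (h : Crossing G D w p.1 p.2) :
    G.dist p.1 p.2 ≠ b - a := by
  rw [Finset.mem_product, mem_level, mem_level] at hp
  have := hw.ecc_add_ecc_le_of_crossing hG h
  omega

lemma le_pairBound (hG : G.IsTree) (hw : IsDiametralPath G D w) {g : ℕ → ℝ} (hg : Antitone g)
    {a b : ℕ} (ha : D + 2 ≤ 2 * a) (hab : a ≤ b) {p : V × V}
    (hp : p ∈ level G a ×ˢ level G b) :
    g (G.dist p.1 p.2) ≤ pairBound G g D w a b p := by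
  have hne := hw.not_dist_eq_of_crossing hG ha hab hp
  rw [Finset.mem_product, mem_level, mem_level] at hp
  unfold pairBound
  by_cases h1 : Crossing G D w p.1 p.2
  · have := hw.ecc_add_ecc_le_of_crossing hG h1
    rw [if_pos h1, if_neg (hne h1)]
    have := hg (show a + b - D ≤ G.dist p.1 p.2 by omega)
    linarith
  · rw [if_neg h1]
    by_cases h2 : G.dist p.1 p.2 = b - a
    · rw [if_pos h2, h2]
      linarith
    · rw [if_neg h2]
      have h3 := ecc_le_ecc_add_dist hG.connected p.2 p.1
      rw [G.dist_comm] at h3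
      have h4 : G.dist p.1 p.2 ≠ b - a + 1 := by
        intro h5
        have := hG.two_mul_ecc_le_of_dist_eq hw.dist_le (u := p.1) (v := p.2) (b - a)
          (by omega) (by rw [G.dist_comm, h5])
        omega
      have := hg (show b - a + 2 ≤ G.dist p.1 p.2 by omega)
      linarith

lemma sum_pairBound_le (hG : G.IsTree) (hw : IsDiametralPath G D w) {g : ℕ → ℝ}
    (hg : Antitone g) {a b : ℕ} (ha : D + 2 ≤ 2 * a) (hab : a ≤ b) (hb : b ≤ D) :
    ∑ p ∈ level G a ×ˢ level G b, pairBound G g D w a b p ≤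
      levelBound g D a b (level G a).card (level G b).card := by
  unfold pairBound levelBound
  have h1 : (((level G a ×ˢ level G b).filter fun p => G.dist p.1 p.2 = b - a).card : ℝ) ≤
      (level G b).card := mod_cast hG.card_ancestor_pairs_le hab
  have h2 : ((level G a).card : ℝ) + (level G b).card ≤
      ((level G a ×ˢ level G b).filter fun p => Crossing G D w p.1 p.2).card + 2 := mod_cast
    hw.card_add_card_le hG (a := a) (b := b) (by omega) (by omega) (by omega) (by omega)
  have h3 : g (b - a + 2) ≤ g (b - a) := hg (by omega)
  have h4 : g (a + b - D) ≤ g (b - a + 2) := hg (by omega)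
  rw [Finset.sum_add_distrib, Finset.sum_add_distrib, ← Finset.sum_filter, ← Finset.sum_filter,
    Finset.sum_const, Finset.sum_const, Finset.sum_const, Finset.card_product]
  simp only [nsmul_eq_mul, Nat.cast_mul]
  nlinarith

lemma levelSum_le (hG : G.IsTree) (hw : IsDiametralPath G D w) {g : ℕ → ℝ}
    (hg : Antitone g) {a b : ℕ} (ha : D + 2 ≤ 2 * a) (hab : a ≤ b) (hb : b ≤ D) :
    levelSum G g a b ≤ levelBound g D a b (level G a).card (level G b).card :=
  (Finset.sum_le_sum fun _ hp => hw.le_pairBound hG hg ha hab hp).trans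
    (hw.sum_pairBound_le hG hg ha hab hb)

lemma dist_eq_of_levelSum_eq (hG : G.IsTree) (hw : IsDiametralPath G D w) {g : ℕ → ℝ}
    (hg : StrictAnti g) {a b : ℕ} (ha : D + 2 ≤ 2 * a) (hab : a ≤ b) (hb : b ≤ D)
    (h : levelSum G g a b = levelBound g D a b (level G a).card (level G b).card)
    {u v : V} (hu : ecc G u = a) (hv : ecc G v = b) :
    (Crossing G D w u v → G.dist u v = a + b - D) ∧
      (¬ Crossing G D w u v → G.dist u v ≠ b - a → G.dist u v = b - a + 2) := by
  have hp : (u, v) ∈ level G a ×ˢ level G b := by simp [hu, hv]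
  have h1 : levelSum G g a b = ∑ p ∈ level G a ×ˢ level G b, pairBound G g D w a b p :=
    le_antisymm (Finset.sum_le_sum fun _ hp => hw.le_pairBound hG hg.antitone ha hab hp)
      (h ▸ hw.sum_pairBound_le hG hg.antitone ha hab hb)
  have h2 := (Finset.sum_eq_sum_iff_of_le fun _ hp =>
    hw.le_pairBound hG hg.antitone ha hab hp).1 h1 _ hp
  simp only [pairBound] at h2
  constructor
  · intro h3
    have h4 := hw.not_dist_eq_of_crossing hG ha hab hp h3
    rw [if_pos h3, if_neg h4] at h2
    exact hg.injective (by linarith)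
  · intro h3 h4
    rw [if_neg h3, if_neg h4] at h2
    exact hg.injective (by linarith)

end IsDiametralPath

end LevelSums

section CaterpillarCoordinates

/-- Coordinates exhibiting `G` as a caterpillar with spine `s 0, …, s D` whose pendent vertices
are placed just before the spine vertex they are attached to, all in the first half. -/
structure IsCaterpillarCoord (G : SimpleGraph V) (D l : ℕ) (pos : V → ℕ) (s : ℕ → V) : Prop where
  pos_le : ∀ v, pos v ≤ D
  pos_spine : ∀ i ≤ D, pos (s i) = i
  eq_spine : ∀ v, l ≤ pos v + 1 → v = s (pos v)
  adj_iff : ∀ u v, G.Adj u v ↔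
    (pos v = pos u + 1 ∧ v = s (pos v)) ∨ (pos u = pos v + 1 ∧ u = s (pos u))
  one_le : 1 ≤ l
  le_two_mul : D + 1 ≤ 2 * l
  two_mul_le : 2 * l ≤ D + 2

namespace IsCaterpillarCoord

variable {G : SimpleGraph V} {D l : ℕ} {pos : V → ℕ} {s : ℕ → V}

lemma adj_spine (h : IsCaterpillarCoord G D l pos s) {u : V} {j : ℕ} (hj : j ≤ D)
    (hu : j = pos u + 1) : G.Adj u (s j) := by
  have := h.pos_spine j hj
  exact (h.adj_iff _ _).2 (Or.inl ⟨by omega, by rw [this]⟩)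

lemma reachable_end (h : IsCaterpillarCoord G D l pos s) (n : ℕ) :
    ∀ u, pos u + n = D → G.Reachable u (s D) := by
  induction n with
  | zero =>
    intro u hu
    have := h.eq_spine u (by have := h.two_mul_le; have := h.one_le; omega)
    rw [show D = pos u by omega, ← this]
  | succ n ih =>
    intro u hu
    have h1 := h.adj_spine (u := u) (j := pos u + 1) (by omega) rfl
    refine h1.reachable.trans (ih _ ?_)
    rw [h.pos_spine _ (by omega)]
    omega

lemma connected (h : IsCaterpillarCoord G D l pos s) : G.Connected := by
  have hr : ∀ u, G.Reachable u (s D) := fun u =>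
    h.reachable_end (D - pos u) u (by have := h.pos_le u; omega)
  have : Nonempty V := ⟨s 0⟩
  exact ⟨fun u v => (hr u).trans (hr v).symm⟩

lemma dist_spine_le (h : IsCaterpillarCoord G D l pos s) {u : V} {j : ℕ} (hj : j ≤ D)
    (hu : pos u < j ∨ u = s j) : G.dist u (s j) ≤ j - pos u := by
  rcases hu with hu | rfl
  · obtain ⟨n, hn⟩ := Nat.exists_eq_add_of_lt hu
    induction n generalizing j with
    | zero =>
      rw [dist_eq_one_iff_adj.2 (h.adj_spine hj (by omega))]
      omega
    | succ n ih =>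
      have h1 := ih (j := pos u + n + 1) (by omega) (by omega) rfl
      have h2 := h.connected.dist_triangle (u := u) (v := s (pos u + n + 1)) (w := s j)
      rw [dist_eq_one_iff_adj.2 (h.adj_spine hj (u := s (pos u + n + 1))
        (by rw [h.pos_spine _ (by omega)]; omega))] at h2
      omega
  · simp

lemma dist_le_of_pos_lt (h : IsCaterpillarCoord G D l pos s) {v : V} {j : ℕ} (hj : j ≤ D)
    (hv : pos v < j) : G.dist (s j) v ≤ j - pos v := by
  rw [G.dist_comm]
  exact h.dist_spine_le hj (Or.inl hv)

lemma dist_le_add_two (h : IsCaterpillarCoord G D l pos s) {u v : V} (huv : pos u ≤ pos v)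
    (hv : pos v < D) : G.dist u v ≤ pos v - pos u + 2 := by
  have h1 := h.dist_spine_le (u := u) (j := pos v + 1) (by omega) (Or.inl (by omega))
  have h2 := h.dist_spine_le (u := v) (j := pos v + 1) (by omega) (Or.inl (by omega))
  have h3 := h.connected.dist_triangle (u := u) (v := s (pos v + 1)) (w := v)
  rw [G.dist_comm (u := s (pos v + 1)) (v := v)] at h3
  omega

lemma pos_le_add_dist (h : IsCaterpillarCoord G D l pos s) (u v : V) :
    pos v ≤ pos u + G.dist u v := by
  obtain ⟨p, hp⟩ := h.connected.exists_walk_length_eq_dist u v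
  rw [← hp]
  clear hp
  induction p with
  | nil => simp
  | @cons x y z hadj q ih =>
    rw [Walk.length_cons]
    have := (h.adj_iff x y).1 hadj
    omega

variable [Fintype V]

lemma ecc_eq (h : IsCaterpillarCoord G D l pos s) (v : V) :
    ecc G v = max (pos v) (D - pos v) := by
  have hv := h.pos_le v
  have hl := h.two_mul_le
  have hl1 := h.one_le
  apply le_antisymm
  · refine Finset.sup_le fun u _ => ?_
    have hu := h.pos_le u
    have upper : ∀ x y : V, pos x ≤ pos y → l ≤ pos y + 1 →
        x = y ∨ G.dist x y ≤ pos y - pos x := fun x y hxy hy => by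
      have h1 := h.eq_spine y hy
      rcases hxy.lt_or_eq with h2 | h2
      · rw [h1, h.pos_spine _ (h.pos_le y)]
        exact Or.inr (h.dist_spine_le (h.pos_le y) (Or.inl h2))
      · refine Or.inl ?_
        rw [h1, ← h2]
        exact h.eq_spine x (by omega)
    have hcomm := G.dist_comm (u := u) (v := v)
    have self : ∀ x : V, G.dist x x = 0 := fun _ => SimpleGraph.dist_self
    rcases le_total (pos u) (pos v) with h1 | h1
    · by_cases h2 : l ≤ pos v + 1
      · rcases upper u v h1 h2 with rfl | h3
        · simp
        · omega
      · have := h.dist_le_add_two h1 (by omega)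
        omega
    · by_cases h2 : l ≤ pos u + 1
      · rcases upper v u h1 h2 with rfl | h3
        · simp
        · omega
      · have := h.dist_le_add_two h1 (by omega)
        omega
  · have h1 := h.pos_le_add_dist (s 0) v
    have h2 := h.pos_le_add_dist v (s D)
    have h3 := dist_le_ecc (G := G) v (s 0)
    have h4 := dist_le_ecc (G := G) v (s D)
    rw [h.pos_spine _ (by omega)] at h1 h2
    rw [G.dist_comm] at h1
    omega

lemma ecc_spine (h : IsCaterpillarCoord G D l pos s) {i : ℕ} (hi : i ≤ D) :
    ecc G (s i) = max i (D - i) := by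
  rw [h.ecc_eq, h.pos_spine i hi]

lemma eq_spine_or (h : IsCaterpillarCoord G D l pos s) {v : V} {a : ℕ} (hv : ecc G v = a) :
    v = s a ∨ pos v = D - a := by
  have h1 := h.ecc_eq v
  have h2 := h.pos_le v
  have h3 := h.two_mul_le
  by_cases h4 : pos v = a
  · left
    rw [← h4]
    have := h.le_two_mul
    exact h.eq_spine v (by omega)
  · right
    omega

/-- Every vertex of eccentricity `b` has an ancestor of eccentricity `a ≤ b`; it lies on the
second half of the spine only if the vertex does. -/
lemma exists_ancestor (h : IsCaterpillarCoord G D l pos s) {a b : ℕ} (ha : D + 2 ≤ 2 * a)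
    (hab : a ≤ b) (hb : b ≤ D) {v : V} (hv : ecc G v = b) :
    ∃ u, ecc G u = a ∧ G.dist u v ≤ b - a ∧ (u = s a ↔ v = s b) := by
  by_cases hvb : v = s b
  · refine ⟨s a, ?_, ?_, by simp [hvb]⟩
    · rw [h.ecc_spine (by omega)]
      omega
    · rcases hab.lt_or_eq with hlt | rfl
      · have := h.dist_spine_le (u := s a) hb (Or.inl (by rwa [h.pos_spine _ (by omega)]))
        rw [h.pos_spine _ (by omega)] at this
        rwa [hvb]
      · simp [hvb]
  · rcases hab.lt_or_eq with hlt | rfl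
    · have h1 := (h.eq_spine_or hv).resolve_left hvb
      refine ⟨s (D - a), ?_, ?_, ?_⟩
      · rw [h.ecc_spine (by omega)]
        omega
      · have := h.dist_le_of_pos_lt (v := v) (j := D - a) (by omega) (by omega)
        omega
      · refine iff_of_false (fun h2 => ?_) hvb
        have := congrArg pos h2
        rw [h.pos_spine _ (by omega), h.pos_spine _ (by omega)] at this
        omega
    · exact ⟨v, hv, by simp, Iff.rfl⟩

lemma levelBound_le (h : IsCaterpillarCoord G D l pos s) {g : ℕ → ℝ} (hg : Antitone g)
    {a b : ℕ} (ha : D + 2 ≤ 2 * a) (hab : a ≤ b) (hb : b ≤ D) :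
    levelBound g D a b (level G a).card (level G b).card ≤ levelSum G g a b := by
  have hanc : ∀ v : V, ∃ u, ecc G v = b →
      ecc G u = a ∧ G.dist u v ≤ b - a ∧ (u = s a ↔ v = s b) := fun v => by
    by_cases hv : ecc G v = b
    · obtain ⟨u, hu⟩ := h.exists_ancestor ha hab hb hv
      exact ⟨u, fun _ => hu⟩
    · exact ⟨v, fun h1 => absurd h1 hv⟩
  choose f hf using hanc
  have hsa : s a ∈ level G a := by
    rw [mem_level, h.ecc_spine (by omega)]
    omega
  have hsb : s b ∈ level G b := by
    rw [mem_level, h.ecc_spine (by omega)]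
    omega
  set c₁ := g (b - a) - g (b - a + 2)
  set c₂ := g (a + b - D) - g (b - a + 2)
  have key : ∀ v ∈ level G b, ∀ u ∈ level G a,
      g (b - a + 2) + (if u = f v then c₁ else 0) +
        ((if u = s a then c₂ else 0) + (if v = s b then c₂ else 0) -
          (if u = s a then if v = s b then 2 * c₂ else 0 else 0)) ≤ g (G.dist u v) := by
    intro v hv u hu
    rw [mem_level] at hv hu
    obtain ⟨-, h1, h2⟩ := hf v hv
    have h3 := h.two_mul_le
    have h4 := h.pos_spine a (by omega)
    have h5 := h.pos_spine b hb
    by_cases hva : v = s b <;> by_cases hua : u = s a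
    · have := hg h1
      have hfu : u = f v := hua.trans (h2.2 hva).symm
      rw [if_pos hfu, if_pos hua, if_pos hua, if_pos hva, if_pos hva, hfu]
      linarith
    · have hfu : u ≠ f v := fun h6 => hua (h6.trans (h2.2 hva))
      have h6 := (h.eq_spine_or hu).resolve_left hua
      have h7 := h.dist_spine_le (u := u) hb (Or.inl (by omega))
      have := hg (show G.dist u v ≤ a + b - D by rw [hva]; omega)
      rw [if_neg hfu, if_neg hua, if_neg hua, if_pos hva]
      linarith
    · have hfu : u ≠ f v := fun h6 => hva (h2.1 (h6.symm.trans hua))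
      have h6 := (h.eq_spine_or hv).resolve_left hva
      have h7 := h.dist_le_of_pos_lt (v := v) (j := a) (by omega) (by omega)
      have := hg (show G.dist u v ≤ a + b - D by rw [hua]; omega)
      rw [if_neg hfu, if_pos hua, if_pos hua, if_neg hva, if_neg hva]
      linarith
    · rw [if_neg hua, if_neg hua, if_neg hva]
      by_cases hfu : u = f v
      · have := hg h1
        rw [if_pos hfu, hfu]
        linarith
      · have h6 := (h.eq_spine_or hv).resolve_left hva
        have h7 := (h.eq_spine_or hu).resolve_left hua
        have h8 := h.dist_le_add_two (u := v) (v := u) (by omega) (by omega)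
        rw [G.dist_comm] at h8
        have := hg (show G.dist u v ≤ b - a + 2 by omega)
        rw [if_neg hfu]
        linarith
  have hsum := Finset.sum_le_sum fun v hv => Finset.sum_le_sum (key v hv)
  unfold levelSum levelBound
  rw [Finset.sum_product_right]
  refine le_of_eq_of_le ?_ hsum
  have hanc_sum : ∑ v ∈ level G b, (if f v ∈ level G a then c₁ else 0) =
      (level G b).card * c₁ := by
    rw [← nsmul_eq_mul, ← Finset.sum_const]
    exact Finset.sum_congr rfl fun v hv => if_pos (mem_level.2 (hf v (mem_level.1 hv)).1)
  simp only [Finset.sum_add_distrib, Finset.sum_sub_distrib, Finset.sum_ite_eq', hsa,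
    hsb, if_true, Finset.sum_const, nsmul_eq_mul, mul_ite, mul_zero, hanc_sum]
  simp only [c₁, c₂]
  ring

lemma centralBound_le (h : IsCaterpillarCoord G D l pos s) {g : ℕ → ℝ} (hg : Antitone g)
    {r b : ℕ} (hr : D + 1 = r + l) (hb : r ≤ b) (hb' : b ≤ D) :
    centralBound g r b (level G r).card (level G b).card ≤ levelSum G g r b := by
  have h1 := h.two_mul_le
  have h2 := h.le_two_mul
  have h3 := h.one_le
  have spine : ∀ u, ecc G u = r → u = s r ∨ u = s (D - r) := fun u hu => by
    refine (h.eq_spine_or hu).imp id fun h4 => ?_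
    rw [← h4]
    exact h.eq_spine u (by omega)
  set f : V → V := fun v => if v = s b then s r else s (D - r)
  have hfr : ∀ v, f v ∈ level G r := fun v => by
    simp only [f, mem_level]
    split_ifs <;> rw [h.ecc_spine (by omega)] <;> omega
  have up : ∀ v, ∀ j ≤ D, pos v ≤ j → l ≤ j + 1 → G.dist (s j) v ≤ j - pos v := by
    intro v j hj hv hj'
    rcases hv.lt_or_eq with hlt | heq
    · exact h.dist_le_of_pos_lt hj hlt
    · rw [← heq, ← h.eq_spine v (by omega)]
      simp
  set c := g (b - r) - g (b - r + 1)
  have key : ∀ v ∈ level G b, ∀ u ∈ level G r,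
      g (b - r + 1) + (if u = f v then c else 0) ≤ g (G.dist u v) := by
    intro v hv u hu
    rw [mem_level] at hv hu
    have h4 : G.dist (f v) v ≤ b - r := by
      simp only [f]
      split_ifs with h5
      · have := up (s r) b hb' (by rw [h.pos_spine r (by omega)]; omega) (by omega)
        rw [h.pos_spine r (by omega)] at this
        rwa [h5, G.dist_comm]
      · have h6 := (h.eq_spine_or hv).resolve_left h5
        have := up v (D - r) (by omega) (by omega) (by omega)
        omega
    by_cases hfu : u = f v
    · have := hg h4
      rw [if_pos hfu, hfu]
      linarith
    · have h5 : G.dist u v ≤ b - r + 1 := by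
        simp only [f] at hfu
        split_ifs at hfu with h6
        · rw [(spine u hu).resolve_left hfu, h6, G.dist_comm]
          have := up (s (D - r)) b hb' (by rw [h.pos_spine _ (by omega)]; omega) (by omega)
          rw [h.pos_spine _ (by omega)] at this
          omega
        · rw [(spine u hu).resolve_right hfu]
          have h7 := (h.eq_spine_or hv).resolve_left h6
          have := up v r (by omega) (by omega) (by omega)
          omega
      have := hg h5
      rw [if_neg hfu]
      linarith
  have hsum := Finset.sum_le_sum fun v hv => Finset.sum_le_sum (key v hv)
  unfold levelSum centralBound
  rw [Finset.sum_product_right]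
  refine le_of_eq_of_le ?_ hsum
  simp only [Finset.sum_add_distrib, Finset.sum_ite_eq', hfr, if_true, Finset.sum_const,
    nsmul_eq_mul]
  ring

end IsCaterpillarCoord

end CaterpillarCoordinates

section Isomorphism

variable {W : Type*} {G : SimpleGraph V} {H : SimpleGraph W}

lemma SimpleGraph.Iso.dist_apply (φ : G ≃g H) (u v : V) :
    H.dist (φ u) (φ v) = G.dist u v := by
  by_cases h : G.Reachable u v
  · apply le_antisymm
    · obtain ⟨p, hp⟩ := h.exists_walk_length_eq_dist
      rw [← hp, ← p.length_map φ.toHom]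
      exact dist_le _
    obtain ⟨p, hp⟩ := ((φ.reachable_iff).2 h).exists_walk_length_eq_dist
    have := G.dist_le (p.map φ.symm.toHom)
    rw [Walk.length_map, hp] at this
    simpa using this
  · rw [dist_eq_zero_of_not_reachable h,
      dist_eq_zero_of_not_reachable (mt (φ.reachable_iff).1 h)]

variable [Fintype V] [Fintype W]

lemma wiener_eq_of_iso (φ : G ≃g H) (g : ℕ → ℝ) : wiener G g = wiener H g := by
  unfold wiener
  congr 1
  refine Finset.sum_equiv (φ.toEquiv.prodCongr φ.toEquiv) (fun p => ?_) fun p _ => ?_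
  · simp
  · exact congrArg g (φ.dist_apply p.1 p.2).symm

namespace IsCaterpillarCoord

variable {D l : ℕ} {pos : V → ℕ} {s : ℕ → V} {pos' : W → ℕ} {s' : ℕ → W}

lemma card_filter_pos (h : IsCaterpillarCoord G D l pos s) (p : ℕ) :
    (Finset.univ.filter fun v => pos v = p).card =
      if p + 1 < l then (level G (D - p)).card - 1 else if p ≤ D then 1 else 0 := by
  have h1 := h.two_mul_le
  split_ifs with hp hp'
  · have h2 : level G (D - p) = insert (s (D - p)) (Finset.univ.filter fun v => pos v = p) := by
      ext v
      simp only [mem_level, Finset.mem_insert, Finset.mem_filter, Finset.mem_univ, true_and]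
      constructor
      · intro hv
        refine (h.eq_spine_or hv).imp id fun h3 => ?_
        omega
      · rintro (rfl | hv)
        · rw [h.ecc_spine (by omega)]
          omega
        · rw [h.ecc_eq]
          omega
    rw [h2, Finset.card_insert_of_notMem, Nat.add_sub_cancel]
    simp only [Finset.mem_filter, Finset.mem_univ, true_and]
    rw [h.pos_spine _ (by omega)]
    omega
  · rw [Finset.card_eq_one]
    refine ⟨s p, ?_⟩
    ext v
    simp only [Finset.mem_filter, Finset.mem_univ, true_and, Finset.mem_singleton]
    constructor
    · rintro rfl
      exact h.eq_spine v (by omega)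
    · rintro rfl
      exact h.pos_spine p hp'
  · rw [Finset.card_eq_zero, Finset.filter_eq_empty_iff]
    rintro v - rfl
    exact hp' (h.pos_le v)

/-- Caterpillar coordinates and the eccentric sequence determine a graph up to isomorphism. -/
lemma nonempty_iso (h : IsCaterpillarCoord G D l pos s) (h' : IsCaterpillarCoord H D l pos' s')
    (hcard : ∀ k, (level G k).card = (level H k).card) : Nonempty (G ≃g H) := by
  have hfib : ∀ p, ∃ e : {v // pos v = p} ≃ {w // pos' w = p},
      ∀ hp : p ≤ D, e ⟨s p, h.pos_spine p hp⟩ = ⟨s' p, h'.pos_spine p hp⟩ := fun p => by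
    have hc : Fintype.card {v // pos v = p} = Fintype.card {w // pos' w = p} := by
      rw [Fintype.card_subtype, Fintype.card_subtype, h.card_filter_pos, h'.card_filter_pos, hcard]
    obtain e := Fintype.equivOfCardEq hc
    by_cases hp : p ≤ D
    · refine ⟨e.trans (Equiv.swap (e ⟨s p, h.pos_spine p hp⟩) ⟨s' p, h'.pos_spine p hp⟩),
        fun _ => ?_⟩
      simp
    · exact ⟨e, fun hp' => absurd hp' hp⟩
  choose e he using hfib
  let φ : V ≃ W := (Equiv.sigmaFiberEquiv pos).symm.trans
    ((Equiv.sigmaCongrRight e).trans (Equiv.sigmaFiberEquiv pos'))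
  have hφ : ∀ v, φ v = (e (pos v) ⟨v, rfl⟩ : W) := fun v => rfl
  have hpos : ∀ v, pos' (φ v) = pos v := fun v => by
    rw [hφ]
    exact (e (pos v) ⟨v, rfl⟩).2
  have hspine : ∀ i ≤ D, φ (s i) = s' i := fun i hi => by
    have h1 : ∀ j (hj : pos (s i) = j), i = j → (e j ⟨s i, hj⟩ : W) = s' i := by
      rintro j hj rfl
      exact congrArg Subtype.val (he i hi)
    exact h1 _ rfl (h.pos_spine i hi).symm
  have hiff : ∀ v, φ v = s' (pos' (φ v)) ↔ v = s (pos v) := fun v => by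
    rw [hpos, ← hspine _ (h.pos_le v), φ.injective.eq_iff]
  refine ⟨⟨φ, fun {u v} => ?_⟩⟩
  rw [h.adj_iff, h'.adj_iff, hiff, hiff, hpos, hpos]

end IsCaterpillarCoord

end Isomorphism

section Extremal

variable [Fintype V] {G : SimpleGraph V}

namespace IsDiametralPath

variable {D : ℕ} {w : ℕ → V}

lemma opp_eq_or (a : ℕ) (v : V) : opp G D w a v = w a ∨ opp G D w a v = w (D - a) := by
  unfold opp
  split_ifs <;> simp

/-- The vertices outside the diametral path that are far from the centre. -/
def Extra (G : SimpleGraph V) (D : ℕ) (w : ℕ → V) (v : V) : Prop :=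
  D + 2 ≤ 2 * ecc G v ∧ v ≠ w (ecc G v) ∧ v ≠ w (D - ecc G v)

lemma Extra.ne_opp {u v : V} (hv : Extra G D w v) : v ≠ opp G D w (ecc G v) u := fun h => by
  rcases opp_eq_or (G := G) (D := D) (w := w) (ecc G v) u with h1 | h1
  · exact hv.2.1 (h.trans h1)
  · exact hv.2.2 (h.trans h1)

variable (hG : G.IsTree) (hw : IsDiametralPath G D w) {g : ℕ → ℝ} (hg : StrictAnti g)
  (heq : ∀ a b, D + 2 ≤ 2 * a → a ≤ b → b ≤ D →
    levelSum G g a b = levelBound g D a b (level G a).card (level G b).card)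

include hG hw hg heq

lemma Extra.dist_spine_eq_two {u v : V} (hv : Extra G D w v)
    (hu : u = w (ecc G v) ∨ u = w (D - ecc G v))
    (huv : u ≠ opp G D w (ecc G v) v ∨ 2 * ecc G v = D + 2) : G.dist u v = 2 := by
  have h1 := hv.1
  have h2 := hw.ecc_le v
  have h3 : ecc G u = ecc G v := by
    rcases hu with rfl | rfl <;> rw [hw.ecc_apply hG (by omega)] <;> omega
  have h4 : G.dist u v ≠ ecc G v - ecc G v := by
    rw [Nat.sub_self, Ne, hG.connected.dist_eq_zero_iff]
    rintro rfl
    exact hu.elim hv.2.1 hv.2.2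
  have h5 := hw.dist_eq_of_levelSum_eq hG hg h1 le_rfl h2 (heq _ _ h1 le_rfl h2) h3 rfl
  by_cases h6 : Crossing G D w u v
  · have h7 := h5.1 h6
    rcases huv with huv | huv
    · rcases h6 with h6 | h6
      · rw [h3] at h6
        exact absurd h6 huv
      · exact absurd h6 hv.ne_opp
    · omega
  · have := h5.2 h6 h4
    omega

lemma Extra.dist_right_eq_iff {u v : V} (hu : Extra G D w u) (hv : Extra G D w v)
    (huv : ecc G u ≤ ecc G v) (h : D + 3 ≤ 2 * ecc G u) :
    G.dist u (w D) = ecc G u ↔ G.dist v (w D) = ecc G v := by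
  have h1 := hw.ecc_le u
  have h2 := hw.ecc_le v
  have h3 := hw.dist_eq_of_levelSum_eq hG hg hu.1 huv h2 (heq _ _ hu.1 huv h2) rfl rfl
  have h4 : ¬ Crossing G D w u v := fun h4 => h4.elim hu.ne_opp hv.ne_opp
  have h5 : G.dist u v ≤ ecc G v - ecc G u + 2 := by
    by_cases h6 : G.dist u v = ecc G v - ecc G u
    · omega
    · exact (h3.2 h4 h6).le
  have h6 := hw.dist_ends
  have h7 := hG.four_point u (w D) (x := v) (y := w 0)
  have h8 := hG.four_point v (w D) (x := u) (y := w 0)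
  have near_right : ∀ z, Extra G D w z → G.dist z (w D) ≠ ecc G z →
      G.dist z (w D) ≤ 2 + (D - ecc G z) := fun z hz hne => by
    have h9 : opp G D w (ecc G z) z = w (D - ecc G z) := if_neg hne
    have h10 := hz.dist_spine_eq_two hG hw hg heq (Or.inl rfl) (Or.inl fun h11 => by
      have := hw.eq_of_apply_eq hG.connected (hw.ecc_le z) (by omega) (h11.trans h9)
      have := hz.1
      omega)
    have h11 := hG.connected.dist_triangle (u := z) (v := w (ecc G z)) (w := w D)
    rw [hw.dist_right hG.connected (hw.ecc_le z), G.dist_comm (u := z) (v := w (ecc G z))] at h11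
    omega
  have near_left : ∀ z, Extra G D w z → G.dist z (w D) = ecc G z →
      G.dist z (w 0) ≤ 2 + (D - ecc G z) := fun z hz he => by
    have h9 : opp G D w (ecc G z) z = w (ecc G z) := if_pos he
    have h10 := hz.dist_spine_eq_two hG hw hg heq (Or.inr rfl) (Or.inl fun h11 => by
      have := hw.eq_of_apply_eq hG.connected (by omega) (hw.ecc_le z) (h11.trans h9)
      have := hz.1
      omega)
    have h11 := hG.connected.dist_triangle (u := z) (v := w (D - ecc G z)) (w := w 0)
    rw [hw.dist_left hG.connected (by omega), G.dist_comm (u := z) (v := w (D - ecc G z))] at h11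
    omega
  have hue := hw.ecc_eq hG u
  have hve := hw.ecc_eq hG v
  rw [G.dist_comm (u := w D) (v := w 0), h6, G.dist_comm (u := w D)] at h7 h8
  rw [G.dist_comm (u := v) (v := u)] at h8
  constructor
  · intro hur
    by_contra hvr
    have := near_left u hu hur
    have := near_right v hv hvr
    omega
  · intro hvr
    by_contra hur
    have := near_left v hv hvr
    have := near_right u hu hur
    omega

/-- In the extremal case all vertices outside a diametral path lie on the same side. -/
lemma exists_one_sided : ∃ w', IsDiametralPath G D w' ∧
    ∀ v, Extra G D w' v → G.dist (w' (D - ecc G v)) v = 2 := by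
  by_cases h : ∃ v, Extra G D w v ∧ D + 3 ≤ 2 * ecc G v ∧ G.dist v (w D) ≠ ecc G v
  · obtain ⟨v₀, h1, h2, h3⟩ := h
    refine ⟨_, hw.reverse, fun v hv => ?_⟩
    have h4 := hw.ecc_le v
    obtain ⟨h5, h6, h7⟩ := hv
    simp only [Nat.sub_sub_self h4] at h7 ⊢
    have hv' : Extra G D w v := ⟨h5, h7, h6⟩
    refine hv'.dist_spine_eq_two hG hw hg heq (Or.inl rfl) ?_
    by_cases h8 : 2 * ecc G v = D + 2
    · exact Or.inr h8
    · left
      have h9 : G.dist v (w D) ≠ ecc G v := by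
        rcases le_total (ecc G v₀) (ecc G v) with hle | hle
        · rwa [Ne, ← h1.dist_right_eq_iff hG hw hg heq hv' hle h2]
        · rwa [Ne, hv'.dist_right_eq_iff hG hw hg heq h1 hle (by omega)]
      rw [opp, if_neg h9]
      intro h10
      have := hw.eq_of_apply_eq hG.connected h4 (by omega) h10
      omega
  · push Not at h
    refine ⟨w, hw, fun v hv => hv.dist_spine_eq_two hG hw hg heq (Or.inr rfl) ?_⟩
    have h1 := hv.1
    have h4 := hw.ecc_le v
    by_cases h8 : 2 * ecc G v = D + 2
    · exact Or.inr h8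
    · left
      rw [opp, if_pos (h v hv (by omega))]
      intro h10
      have := hw.eq_of_apply_eq hG.connected (by omega) h4 h10
      omega

end IsDiametralPath

end Extremal

section OneSided

variable [Fintype V] {G : SimpleGraph V} {D : ℕ} {w : ℕ → V}

namespace IsDiametralPath

lemma two_mul_ecc_ge (hG : G.IsTree) (hw : IsDiametralPath G D w) (v : V) : D ≤ 2 * ecc G v := by
  have h1 := hw.ecc_eq hG v
  have h2 := hG.connected.dist_triangle (u := w 0) (v := v) (w := w D)
  rw [hw.dist_ends, G.dist_comm] at h2
  omega

lemma adj_of_dist_eq_two (hG : G.IsTree) (hw : IsDiametralPath G D w) {u : V}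
    (hu : D + 2 ≤ 2 * ecc G u) (hu' : u ≠ w (D - ecc G u))
    (h : G.dist (w (D - ecc G u)) u = 2) : G.Adj u (w (D - ecc G u + 1)) := by
  have hle := hw.ecc_le u
  rw [G.dist_comm] at h
  obtain ⟨x, hx, hx'⟩ := hG.connected.exists_adj_dist_eq h
  rw [dist_eq_one_iff_adj] at hx'
  have h1 := hw.ecc_apply hG (i := D - ecc G u) (by omega)
  have h2 := hw.ecc_apply hG (i := D - ecc G u + 1) (by omega)
  rcases le_total (ecc G x) (ecc G u) with h3 | h3
  · have := hG.eq_of_adj_of_ecc_le hx'.symm (hw.adj (D - ecc G u) (by omega)) (by omega) (by omega)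
    rwa [← this]
  · exact absurd (hG.eq_of_adj_of_ecc_le hx.symm hx' h3 (by omega)) hu'

/-- The coordinate of a vertex: its index on the diametral path, if any. -/
noncomputable def coord (G : SimpleGraph V) (D : ℕ) (w : ℕ → V) (v : V) : ℕ :=
  if v = w (ecc G v) then ecc G v else D - ecc G v

lemma coord_apply (hG : G.IsTree) (hw : IsDiametralPath G D w) {i : ℕ} (hi : i ≤ D) :
    coord G D w (w i) = i := by
  have h1 := hw.ecc_apply hG hi
  unfold coord
  split_ifs with h
  · exact (hw.eq_of_apply_eq hG.connected hi (hw.ecc_le _) h).symm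
  · have : ecc G (w i) ≠ i := fun h2 => h (by rw [h2])
    omega

lemma isCaterpillarCoord (hG : G.IsTree) (hw : IsDiametralPath G D w)
    (hcentral : ∀ v, 2 * ecc G v ≤ D + 1 → v = w (ecc G v) ∨ v = w (D - ecc G v))
    (hext : ∀ v, Extra G D w v → G.dist (w (D - ecc G v)) v = 2) {l : ℕ}
    (h1 : 1 ≤ l) (h2 : D + 1 ≤ 2 * l) (h3 : 2 * l ≤ D + 2) :
    IsCaterpillarCoord G D l (coord G D w) w := by
  have hcases : ∀ v, v = w (coord G D w v) ∨
      Extra G D w v ∧ coord G D w v = D - ecc G v := fun v => by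
    by_cases h4 : v = w (ecc G v)
    · left
      rwa [coord, if_pos h4]
    · have h5 : coord G D w v = D - ecc G v := if_neg h4
      by_cases h6 : v = w (D - ecc G v)
      · left
        rwa [h5]
      · refine Or.inr ⟨⟨?_, h4, h6⟩, h5⟩
        by_contra h7
        exact (hcentral v (by omega)).elim h4 h6
  have hle : ∀ v, coord G D w v ≤ D := fun v => by
    have := hw.ecc_le v
    unfold coord
    split_ifs <;> omega
  have hspine : ∀ i ≤ D, coord G D w (w i) = i := fun i hi => hw.coord_apply hG hi
  have hadj : ∀ u v, coord G D w v = coord G D w u + 1 → v = w (coord G D w v) →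
      G.Adj u v := by
    intro u v huv hv
    have h4 := hle v
    rcases hcases u with h5 | ⟨h5, h6⟩
    · have := hw.adj (coord G D w u) (by omega)
      rwa [← h5, ← huv, ← hv] at this
    · have := hw.adj_of_dist_eq_two hG h5.1 h5.2.2 (hext u h5)
      rwa [← h6, ← huv, ← hv] at this
  have hadj' : ∀ u v, G.Adj u v → ecc G v ≤ ecc G u →
      (coord G D w v = coord G D w u + 1 ∧ v = w (coord G D w v)) ∨
        (coord G D w u = coord G D w v + 1 ∧ u = w (coord G D w u)) := by
    intro u v huv hecc
    have h4 := hle u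
    have h5 := hle v
    have h6 := hw.ecc_le u
    rcases hcases u with h7 | ⟨h7, h8⟩
    · have h8 : ecc G u = max (coord G D w u) (D - coord G D w u) := by
        conv_lhs => rw [h7]
        exact hw.ecc_apply hG h4
      by_cases h9 : D + 2 ≤ 2 * ecc G u
      · by_cases h10 : D + 2 ≤ 2 * coord G D w u
        · right
          obtain ⟨n, hn⟩ : ∃ n, coord G D w u = n + 1 := ⟨coord G D w u - 1, by omega⟩
          have h11 := hw.adj n (by omega)
          rw [← hn, ← h7] at h11
          have h12 := hw.ecc_apply hG (i := n) (by omega)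
          have := hG.eq_of_adj_of_ecc_le huv h11.symm hecc (by omega)
          rw [this, hspine n (by omega)]
          exact ⟨hn, h7⟩
        · left
          have h11 := hw.adj (coord G D w u) (by omega)
          rw [← h7] at h11
          have h12 := hw.ecc_apply hG (i := coord G D w u + 1) (by omega)
          have := hG.eq_of_adj_of_ecc_le huv h11 hecc (by omega)
          rw [this, hspine _ (by omega)]
          exact ⟨rfl, rfl⟩
      · rcases hcases v with h10 | ⟨h10, -⟩
        · have h11 : ecc G v = max (coord G D w v) (D - coord G D w v) := by
            conv_lhs => rw [h10]
            exact hw.ecc_apply hG h5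
          have h12 : coord G D w u ≠ coord G D w v := fun h => by
            rw [h7, h10, h] at huv
            exact huv.ne rfl
          rcases h12.lt_or_gt with h13 | h13
          · exact Or.inl ⟨by omega, h10⟩
          · exact Or.inr ⟨by omega, h7⟩
        · have := h10.1
          omega
    · left
      have h9 := h7.1
      have h10 := hw.adj_of_dist_eq_two hG h7.1 h7.2.2 (hext u h7)
      have h11 := hw.ecc_apply hG (i := D - ecc G u + 1) (by omega)
      have := hG.eq_of_adj_of_ecc_le huv h10 hecc (by omega)
      rw [this, hspine _ (by omega), h8]
      exact ⟨rfl, rfl⟩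
  refine ⟨hle, hspine, fun v hv => ?_, fun u v => ⟨fun h => ?_, fun h => ?_⟩, h1, h2, h3⟩
  · rcases hcases v with h4 | ⟨h4, h5⟩
    · exact h4
    · have := h4.1
      have := hw.ecc_le v
      omega
  · rcases le_total (ecc G v) (ecc G u) with h4 | h4
    · exact hadj' u v h h4
    · exact (hadj' v u h.symm h4).symm
  · rcases h with h | h
    · exact hadj u v h.1 h.2
    · exact (hadj v u h.1 h.2).symm

end IsDiametralPath

end OneSided

section StandardCaterpillar

/-- The index on the spine that a vertex of the standard caterpillar is aligned with. -/
def stdPos (r l : ℕ) (m : ℕ → ℕ) : StdVert r l m → ℕ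
  | Sum.inl i => i
  | Sum.inr ⟨i, _⟩ => l - 2 - i

/-- The spine of the standard caterpillar. -/
def stdSpine (r l : ℕ) (m : ℕ → ℕ) (h : 0 < r + l) (i : ℕ) : StdVert r l m :=
  if hi : i < r + l then Sum.inl ⟨i, hi⟩ else Sum.inl ⟨0, h⟩

lemma isCaterpillarCoord_stdCat (r l : ℕ) (m : ℕ → ℕ) (hl : 2 ≤ l)
    (hrl : l = r ∨ l = r + 1) (h : 0 < r + l) :
    IsCaterpillarCoord (stdCat r l m) (r + l - 1) l (stdPos r l m) (stdSpine r l m h) where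
  pos_le v := by
    rcases v with i | ⟨i, j⟩ <;> simp only [stdPos] <;> omega
  pos_spine i hi := by
    rw [stdSpine, dif_pos (by omega)]
    rfl
  eq_spine v hv := by
    rcases v with i | ⟨i, j⟩ <;> simp only [stdPos] at hv ⊢
    · rw [stdSpine, dif_pos i.2]
    · omega
  adj_iff u v := by
    have hleft : ∀ v : StdVert r l m, v = stdSpine r l m h (stdPos r l m v) ↔
        v.isLeft = true := fun v => by
      rcases v with a | ⟨i, j⟩
      · simp [stdSpine, stdPos]
      · simp only [stdSpine]
        split_ifs <;> simp
    rw [stdCat, SimpleGraph.fromRel_adj, hleft, hleft]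
    rcases u with a | ⟨i, j⟩ <;> rcases v with b | ⟨i', j'⟩
    · simp [stdRel, stdPos, Fin.ext_iff]
      omega
    · simp [stdRel, stdPos]
      omega
    · simp [stdRel, stdPos]
      omega
    · simp [stdRel]
  one_le := by omega
  le_two_mul := by omega
  two_mul_le := by omega

end StandardCaterpillar

section Comparison

variable {W : Type*} [Fintype V] [Fintype W] {G : SimpleGraph V} {H : SimpleGraph W}
  {D r l : ℕ} {pos : W → ℕ} {s : ℕ → W}

lemma exists_ecc_eq_of_card_level_eq (hcard : ∀ k, (level G k).card = (level H k).card) (v : V) :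
    ∃ w, ecc H w = ecc G v := by
  have h1 : (level G (ecc G v)).Nonempty := ⟨v, mem_level.2 rfl⟩
  rw [← Finset.card_pos, hcard, Finset.card_pos] at h1
  obtain ⟨w, hw⟩ := h1
  exact ⟨w, mem_level.1 hw⟩

lemma card_level_eq_of_sameEccSeq (h : sameEccSeq G H) (k : ℕ) :
    (level G k).card = (level H k).card := by
  have := h k
  rwa [Nat.card_eq_fintype_card, Nat.card_eq_fintype_card, Fintype.card_subtype,
    Fintype.card_subtype] at this

namespace IsCaterpillarCoord

lemma radius_le_ecc (h : IsCaterpillarCoord H D l pos s) (hr : D + 1 = r + l) (v : W) :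
    r ≤ ecc H v := by
  have h1 := h.ecc_eq v
  have h2 := h.two_mul_le
  have h3 := h.le_two_mul
  omega

lemma card_level_radius_le (h : IsCaterpillarCoord H D l pos s) (hr : D + 1 = r + l) :
    (level H r).card ≤ ({r, D - r} : Finset ℕ).card := by
  refine (Finset.card_le_card (t := ({r, D - r} : Finset ℕ).image s) fun v hv => ?_).trans
    Finset.card_image_le
  rw [mem_level] at hv
  have h2 := h.two_mul_le
  simp only [Finset.image_insert, Finset.image_singleton, Finset.mem_insert, Finset.mem_singleton]
  refine (h.eq_spine_or hv).imp id fun h4 => ?_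
  rw [← h4]
  exact h.eq_spine v (by omega)

variable (h : IsCaterpillarCoord H D l pos s) (hr : D + 1 = r + l)
  (hcard : ∀ k, (level G k).card = (level H k).card)

include h hcard

lemma ecc_le_of_card_level_eq (v : V) : ecc G v ≤ D := by
  obtain ⟨w, hw⟩ := exists_ecc_eq_of_card_level_eq hcard v
  rw [← hw, h.ecc_eq]
  have := h.pos_le w
  omega

lemma exists_isDiametralPath (hG : G.IsTree) : ∃ w, IsDiametralPath G D w := by
  obtain ⟨v, hv⟩ := exists_ecc_eq_of_card_level_eq (fun k => (hcard k).symm) (s D)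
  rw [h.ecc_spine le_rfl] at hv
  obtain ⟨u, hu⟩ := exists_dist_eq_ecc (G := G) v
  exact _root_.exists_isDiametralPath hG.connected
    (fun x y => (dist_le_ecc x y).trans (h.ecc_le_of_card_level_eq hcard x))
    (hu.trans (hv.trans (by omega)))

lemma card_eq_of_card_level_eq : Fintype.card V = Fintype.card W := by
  have hmem : ∀ v ∈ (Finset.univ : Finset V), ecc G v ∈ range (D + 1) := fun v _ =>
    Finset.mem_range.2 (Nat.lt_succ_of_le (h.ecc_le_of_card_level_eq hcard v))
  have hmem' : ∀ v ∈ (Finset.univ : Finset W), ecc H v ∈ range (D + 1) := fun v _ =>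
    Finset.mem_range.2 (Nat.lt_succ_of_le (h.ecc_le_of_card_level_eq (fun _ => rfl) v))
  rw [← Finset.card_univ, ← Finset.card_univ, Finset.card_eq_sum_card_fiberwise hmem,
    Finset.card_eq_sum_card_fiberwise hmem']
  exact Finset.sum_congr rfl fun k _ => hcard k

include hr

lemma levelSum_le (hG : G.IsTree) {g : ℕ → ℝ} (hg : Antitone g) {a b : ℕ} (ha : a ≤ D)
    (hb : b ≤ D) : levelSum G g a b ≤ levelSum H g a b := by
  wlog hab : a ≤ b generalizing a b
  · rw [levelSum_comm g a b, levelSum_comm g a b]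
    exact this hb ha (by omega)
  have h2 := h.two_mul_le
  rcases lt_trichotomy a r with h3 | rfl | h3
  · have h4 : level H a = ∅ := Finset.eq_empty_of_forall_notMem fun v hv => by
      have := h.radius_le_ecc hr v
      rw [mem_level] at hv
      omega
    have h5 : level G a = ∅ := by rw [← Finset.card_eq_zero, hcard, h4, Finset.card_empty]
    simp [levelSum, h4, h5]
  · refine (levelSum_le_centralBound hG hg hab).trans ?_
    rw [hcard, hcard]
    exact h.centralBound_le hg hr hab hb
  · obtain ⟨w, hw⟩ := h.exists_isDiametralPath hcard hG
    refine (hw.levelSum_le hG hg (by omega) hab hb).trans ?_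
    rw [hcard, hcard]
    exact h.levelBound_le hg (by omega) hab hb

/-- A caterpillar with coordinates maximizes the Wiener-type index among all trees with its
eccentric sequence. -/
theorem wiener_le (hG : G.IsTree) {g : ℕ → ℝ} (hg : Antitone g) : wiener G g ≤ wiener H g := by
  have h1 := two_mul_wiener_add (h.ecc_le_of_card_level_eq hcard) g
  have h2 := two_mul_wiener_add (h.ecc_le_of_card_level_eq (G := H) fun _ => rfl) g
  rw [h.card_eq_of_card_level_eq hcard] at h1
  have h3 := Finset.sum_le_sum fun a ha => Finset.sum_le_sum fun b hb =>
    h.levelSum_le hr hcard hG hg (Finset.mem_range_succ_iff.1 ha) (Finset.mem_range_succ_iff.1 hb)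
  linarith

lemma levelSum_eq_of_wiener_eq (hG : G.IsTree) {g : ℕ → ℝ} (hg : Antitone g)
    (heq : wiener G g = wiener H g) {a b : ℕ} (ha : a ≤ D) (hb : b ≤ D) :
    levelSum G g a b = levelSum H g a b := by
  have h1 := two_mul_wiener_add (h.ecc_le_of_card_level_eq hcard) g
  have h2 := two_mul_wiener_add (h.ecc_le_of_card_level_eq (G := H) fun _ => rfl) g
  rw [h.card_eq_of_card_level_eq hcard, heq, h2] at h1
  have hle : ∀ a ∈ range (D + 1), ∀ b ∈ range (D + 1), levelSum G g a b ≤ levelSum H g a b :=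
    fun a ha b hb => h.levelSum_le hr hcard hG hg (Finset.mem_range_succ_iff.1 ha)
      (Finset.mem_range_succ_iff.1 hb)
  have h3 := (Finset.sum_eq_sum_iff_of_le fun a ha => Finset.sum_le_sum (hle a ha)).1 h1.symm a
    (Finset.mem_range_succ_iff.2 ha)
  exact (Finset.sum_eq_sum_iff_of_le (hle a (Finset.mem_range_succ_iff.2 ha))).1 h3 b
    (Finset.mem_range_succ_iff.2 hb)

/-- Equality in `IsCaterpillarCoord.wiener_le` for strictly decreasing weights. -/
theorem nonempty_iso_of_wiener_eq (hG : G.IsTree) {g : ℕ → ℝ} (hg : StrictAnti g)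
    (heq : wiener G g = wiener H g) : Nonempty (G ≃g H) := by
  have h2 := h.two_mul_le
  have h3 := h.le_two_mul
  obtain ⟨w, hw⟩ := h.exists_isDiametralPath hcard hG
  obtain ⟨w, hw, hext⟩ := hw.exists_one_sided hG hg fun a b ha hab hb => by
    refine (hw.levelSum_le hG hg.antitone ha hab hb).antisymm ?_
    rw [h.levelSum_eq_of_wiener_eq hr hcard hG hg.antitone heq (hab.trans hb) hb, hcard, hcard]
    exact h.levelBound_le hg.antitone ha hab hb
  have hinj : Set.InjOn w ({r, D - r} : Finset ℕ) := fun i hi j hj hij => by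
    simp only [Finset.coe_insert, Finset.coe_singleton, Set.mem_insert_iff,
      Set.mem_singleton_iff] at hi hj
    have := h.one_le
    exact hw.eq_of_apply_eq hG.connected (by omega) (by omega) hij
  have hlevel : ({r, D - r} : Finset ℕ).image w = level G r := by
    refine Finset.eq_of_subset_of_card_le (fun v hv => ?_) ?_
    · rw [Finset.mem_image] at hv
      obtain ⟨i, hi, rfl⟩ := hv
      rw [Finset.mem_insert, Finset.mem_singleton] at hi
      have := h.one_le
      rw [mem_level, hw.ecc_apply hG (by omega)]
      omega
    · rw [Finset.card_image_of_injOn hinj, hcard]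
      exact h.card_level_radius_le hr
  refine (hw.isCaterpillarCoord hG (fun v hv => ?_) hext h.one_le h3 h2).nonempty_iso h hcard
  have h4 := hw.two_mul_ecc_ge hG v
  have h5 : ecc G v = r := by omega
  have h6 : v ∈ level G r := mem_level.2 h5
  rw [← hlevel] at h6
  rw [h5]
  simpa [eq_comm] using h6

end IsCaterpillarCoord

end Comparison

/-- If `g` is nonnegative and nonincreasing and `S = (r; m₂,…,m_l)` is a tree
eccentric sequence, then every tree `T` with eccentric sequence `S` satisfies
`W(T;g) ≤ W(T(r; m₂,…,m_l); g)`; if `g` is strictly decreasing, equality holds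
iff `T ≅ T(r; m₂,…,m_l)`. -/
theorem stmt15 [Fintype V] (r l : ℕ) (m : ℕ → ℕ)
    (hr : 1 ≤ r) (hl : 2 ≤ l) (hrl : l = r ∨ l = r + 1)
    (hm : ∀ j : ℕ, 2 ≤ j → j ≤ l → 2 ≤ m j)
    (g : ℕ → ℝ) (hg0 : ∀ n : ℕ, 0 ≤ g n) (hganti : Antitone g)
    (G : SimpleGraph V) (hG : G.IsTree) (hseq : sameEccSeq G (stdCat r l m)) :
    wiener G g ≤ wiener (stdCat r l m) g ∧
      (StrictAnti g →
        (wiener G g = wiener (stdCat r l m) g ↔ Nonempty (G ≃g stdCat r l m))) := by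
  have h := isCaterpillarCoord_stdCat r l m hl hrl (by omega)
  have hcard := card_level_eq_of_sameEccSeq hseq
  have hD : r + l - 1 + 1 = r + l := by omega
  exact ⟨h.wiener_le hD hcard hG hganti, fun hg => ⟨h.nonempty_iso_of_wiener_eq hD hcard hG hg,
    fun ⟨φ⟩ => wiener_eq_of_iso φ g⟩⟩
end

section
/- Let S be a tree eccentric sequence of a tree on n vertices and let k ∈ {2,...,n-1}. If T minimises SW_k among all trees with eccentric sequence S, then T is a caterpillar. -/
open SimpleGraph Finset

attribute [local instance] Classical.propDecidable

variable {V : Type*}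

namespace SimpleGraph

variable {G H : SimpleGraph V}

lemma IsTree.eq_of_adj_of_dist_lt_s16 (hG : G.IsTree) {r w x y : V} (hx : G.Adj w x)
    (hy : G.Adj w y) (hxr : G.dist r x < G.dist r w) (hyr : G.dist r y < G.dist r w) :
    x = y := by
  have key : ∀ z, G.Adj w z → G.dist r z < G.dist r w →
      ∃ p : G.Walk r w, p.IsPath ∧ p.penultimate = z := by
    intro z hz hzr
    obtain ⟨p, hp⟩ := hG.connected.exists_walk_length_eq_dist r z
    refine ⟨p.concat hz.symm, Walk.isPath_of_length_eq_dist _ ?_, by simp⟩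
    have := G.dist_le (p.concat hz.symm)
    rw [Walk.length_concat] at *
    omega
  obtain ⟨p, hp, rfl⟩ := key x hx hxr
  obtain ⟨q, hq, rfl⟩ := key y hy hyr
  rw [(hG.existsUnique_path r w).unique hp hq]

lemma IsTree.dist_adj_cases_s16 (hG : G.IsTree) (r : V) {x y : V} (h : G.Adj x y) :
    G.dist r x = G.dist r y + 1 ∨ G.dist r y = G.dist r x + 1 := by
  have h1 := hG.dist_ne_of_adj r h
  have h2 := h.diff_dist_adj (u := r)
  omega

lemma Connected.exists_adj_dist_add_one (hG : G.Connected) {x r : V} (h : x ≠ r) :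
    ∃ y, G.Adj x y ∧ G.dist r x = G.dist r y + 1 := by
  obtain ⟨p, hp⟩ := hG.exists_walk_length_eq_dist x r
  cases p with
  | nil => exact absurd rfl h
  | @cons _ y _ hxy q =>
    refine ⟨y, hxy, ?_⟩
    have h1 := G.dist_le q
    have h2 := hG.dist_triangle (u := r) (v := y) (w := x)
    rw [dist_eq_one_iff_adj.2 hxy.symm] at h2
    rw [Walk.length_cons, dist_comm] at hp
    rw [dist_comm] at h1
    omega

/-- The only edge joining the two sides of an edge `uv` of a tree is `uv` itself. -/
lemma IsTree.eq_of_adj_of_sides (hG : G.IsTree) {u v p q : V} (huv : G.Adj u v)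
    (hpq : G.Adj p q) (hp : G.dist p u < G.dist p v) (hq : G.dist q v < G.dist q u) :
    p = u ∧ q = v := by
  have h1 := hG.dist_adj_cases_s16 p huv
  have h2 := hG.dist_adj_cases_s16 q huv
  have h3 := hG.dist_adj_cases_s16 u hpq
  have h4 := hG.dist_adj_cases_s16 v hpq
  simp only [dist_comm (u := u), dist_comm (u := v)] at h3 h4
  have hpu : p = u := by
    by_contra hne
    obtain ⟨y, hy, hyd⟩ := hG.connected.exists_adj_dist_add_one hne
    have h5 := hG.dist_adj_cases_s16 y huv
    have h6 := hG.dist_adj_cases_s16 v hy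
    have : y = q := hG.eq_of_adj_of_dist_lt_s16 (r := v) hy hpq
      (by simp only [dist_comm (u := u), dist_comm (u := v)] at *; omega)
      (by simp only [dist_comm (u := u), dist_comm (u := v)] at *; omega)
    subst this
    simp only [dist_comm (u := u), dist_comm (u := v)] at *
    omega
  subst hpu
  refine ⟨rfl, ?_⟩
  rw [dist_self] at *
  have : G.dist q v = 0 := by omega
  exact hG.connected.dist_eq_zero_iff.1 this

/-- A walk between the two sides of an edge `uv` of a tree passes through `u` and `v`. -/
lemma IsTree.mem_support_of_sides (hG : G.IsTree) {u v x y : V} (huv : G.Adj u v)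
    (hx : G.dist x u < G.dist x v) (hy : G.dist y v < G.dist y u) (p : G.Walk x y) :
    u ∈ p.support ∧ v ∈ p.support := by
  obtain ⟨d, hd, h1, h2⟩ := p.exists_boundary_dart {z | G.dist z u < G.dist z v} hx
    (by simp only [Set.mem_ofPred_eq]; omega)
  have h3 := hG.dist_adj_cases_s16 d.snd huv
  simp only [Set.mem_ofPred_eq] at h1 h2
  obtain ⟨h4, h5⟩ := hG.eq_of_adj_of_sides huv d.adj h1 (by omega)
  exact ⟨h4 ▸ p.dart_fst_mem_support_of_mem_darts hd,
    h5 ▸ p.dart_snd_mem_support_of_mem_darts hd⟩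

lemma IsTree.dist_of_sides (hG : G.IsTree) {u v x y : V} (huv : G.Adj u v)
    (hx : G.dist x u < G.dist x v) (hy : G.dist y v < G.dist y u) :
    G.dist x y = G.dist x u + 1 + G.dist v y := by
  obtain ⟨p, hp⟩ := hG.connected.exists_walk_length_eq_dist x y
  have hu := (hG.mem_support_of_sides huv hx hy p).1
  have h1 := congrArg Walk.length (p.take_spec hu)
  rw [Walk.length_append] at h1
  have h2 := G.dist_le (p.takeUntil u hu)
  have h3 := G.dist_le (p.dropUntil u hu)
  have h4 := hG.dist_adj_cases_s16 y huv
  have h5 := hG.connected.dist_triangle (u := x) (v := u) (w := y)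
  rw [dist_comm (v := y)] at *
  rw [dist_comm (u := v)]
  rw [dist_comm (u := u) (v := y)] at *
  omega

/-- The four-point condition. -/
lemma IsTree.four_point_s16 (hG : G.IsTree) (x y a b : V) :
    G.dist x y + G.dist a b ≤
      max (G.dist x a + G.dist y b) (G.dist x b + G.dist y a) := by
  induction hn : G.dist b a generalizing a with
  | zero =>
    obtain rfl := hG.connected.dist_eq_zero_iff.1 hn
    have := hG.connected.dist_triangle (u := x) (v := b) (w := y)
    simp only [dist_self, dist_comm (u := y)]
    omega
  | succ n ih =>
    have hne : a ≠ b := by rintro rfl; simp at hn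
    obtain ⟨c, hac, hc⟩ := hG.connected.exists_adj_dist_add_one hne
    have h1 := ih c (by omega)
    have hx := hG.dist_adj_cases_s16 x hac
    have hy := hG.dist_adj_cases_s16 y hac
    have hside : G.dist b c < G.dist b a := by omega
    have t := hG.connected.dist_triangle (u := x) (v := a) (w := y)
    have hxs : G.dist x a < G.dist x c → G.dist x b = G.dist x a + 1 + G.dist c b :=
      fun h => hG.dist_of_sides hac h hside
    have hys : G.dist y a < G.dist y c → G.dist y b = G.dist y a + 1 + G.dist c b :=
      fun h => hG.dist_of_sides hac h hside
    rw [dist_comm (u := a) (v := y)] at t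
    rw [dist_comm (u := c) (v := b)] at *
    rw [dist_comm (u := a) (v := b)]
    omega

lemma IsTree.dist_le_max_of_diametral (hG : G.IsTree) {a b : V}
    (hab : ∀ x y, G.dist x y ≤ G.dist a b) (x y : V) :
    G.dist x y ≤ max (G.dist x a) (G.dist x b) := by
  have := hG.four_point_s16 x y a b
  have := hab y a
  have := hab y b
  omega

lemma Connected.le_add_dist (hH : H.Connected) {f : V → ℕ}
    (hf : ∀ x y, H.Adj x y → f x ≤ f y + 1) (x y : V) : f x ≤ f y + H.dist x y := by
  obtain ⟨p, hp⟩ := hH.exists_walk_length_eq_dist x y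
  rw [← hp]
  clear hp
  induction p with
  | nil => simp
  | cons h q ih =>
    have := hf _ _ h
    rw [Walk.length_cons]
    omega

lemma Connected.dist_map_le (hG : G.Connected) (hH : H.Connected) {g : V → V}
    (hg : ∀ x y, H.Adj x y → g x = g y ∨ G.Adj (g x) (g y)) (x y : V) :
    G.dist (g x) (g y) ≤ H.dist x y := by
  have := hH.le_add_dist (f := fun z => G.dist (g z) (g y)) (fun p q hpq => by
    rcases hg p q hpq with h | h
    · simp [h]
    · have := hG.dist_triangle (u := g p) (v := g q) (w := g y)
      rw [dist_eq_one_iff_adj.2 h] at this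
      omega) x y
  simpa using this

lemma induce_image_connected {S : Finset V} (hS : (G.induce (S : Set V)).Connected) {g : V → V}
    (hg : ∀ x y, G.Adj x y → g x = g y ∨ H.Adj (g x) (g y)) :
    (H.induce (S.image g : Set V)).Connected := by
  have hmem : ∀ x : (S : Set V), g x ∈ (S.image g : Set V) := fun x =>
    Finset.mem_coe.2 (Finset.mem_image_of_mem g x.2)
  have key : ∀ x y : (S : Set V), (H.induce (S.image g : Set V)).Reachable
      ⟨g x, hmem x⟩ ⟨g y, hmem y⟩ := by
    intro x y
    obtain ⟨p⟩ := hS.preconnected x y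
    induction p with
    | nil => rfl
    | @cons a b c h q ih =>
      refine Reachable.trans ?_ ih
      rcases hg a b h with h' | h'
      · simp only [h']; rfl
      · exact Adj.reachable h'
  obtain ⟨⟨s, hs⟩⟩ := hS.nonempty
  refine (connected_iff _).2 ⟨?_, ⟨⟨g s, hmem ⟨s, hs⟩⟩⟩⟩
  rintro ⟨x, hx⟩ ⟨y, hy⟩
  obtain ⟨x, hx', rfl⟩ := Finset.mem_image.1 (Finset.mem_coe.1 hx)
  obtain ⟨y, hy', rfl⟩ := Finset.mem_image.1 (Finset.mem_coe.1 hy)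
  exact key ⟨x, hx'⟩ ⟨y, hy'⟩

lemma induce_insert_connected {S : Finset V} (hS : (G.induce (S : Set V)).Connected) {u v : V}
    (hv : v ∈ S) (huv : G.Adj u v) : (G.induce (insert u S : Finset V)).Connected := by
  have h := induce_union_connected (G := G) (s := {u, v}) (t := S)
    (induce_pair_connected_of_adj huv).preconnected hS.preconnected ⟨v, by simp, hv⟩
  have heq : ((insert u S : Finset V) : Set V) = {u, v} ∪ (S : Set V) := by
    ext z
    simp only [Finset.coe_insert, Set.mem_insert_iff, Set.mem_union, Set.mem_singleton_iff,
      Finset.mem_coe]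
    constructor
    · tauto
    · rintro ((h | rfl) | h) <;> tauto
  rwa [heq]

/-- A connected vertex set meeting both sides of an edge `uv` of a tree contains `u` and `v`. -/
lemma IsTree.mem_of_induce_connected (hG : G.IsTree) {u v x y : V} (huv : G.Adj u v)
    {S : Finset V} (hS : (G.induce (S : Set V)).Connected) (hxS : x ∈ S) (hyS : y ∈ S)
    (hx : G.dist x u < G.dist x v) (hy : G.dist y v < G.dist y u) : u ∈ S ∧ v ∈ S := by
  obtain ⟨p⟩ := hS.preconnected ⟨x, hxS⟩ ⟨y, hyS⟩
  let f : G.induce (S : Set V) →g G := (Embedding.induce (S : Set V)).toHom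
  have h := hG.mem_support_of_sides (x := f ⟨x, hxS⟩) (y := f ⟨y, hyS⟩) huv hx hy (p.map f)
  simp only [Walk.support_map, List.mem_map] at h
  obtain ⟨⟨s, -, rfl⟩, ⟨t, -, rfl⟩⟩ := h
  exact ⟨s.2, t.2⟩

/-- The map sending `u` to `t` and fixing all other vertices. -/
noncomputable def collapse (u t x : V) : V := if x = u then t else x

/-- The graph obtained from `G` by identifying `u` with `u'` and reattaching `u` to `v`. -/
def shift (G : SimpleGraph V) (u u' v : V) : SimpleGraph V :=
  fromEdgeSet (Sym2.map (collapse u u') '' G.edgeSet ∪ {s(u, v)})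

/-- The branch hanging at `u` away from its neighbour `v`, without `u` itself. -/
def branch (G : SimpleGraph V) (u v : V) : Set V :=
  {x | G.dist x u < G.dist x v ∧ x ≠ u}

/-- The map sending a set `B` to the vertex `u` and fixing all other vertices. -/
noncomputable def retract (B : Set V) (u x : V) : V := if x ∈ B then u else x

lemma mem_branch {u v x : V} : x ∈ G.branch u v ↔ G.dist x u < G.dist x v ∧ x ≠ u := Iff.rfl

lemma collapse_self (u u' : V) : collapse u u' u = u' := if_pos rfl

lemma collapse_of_ne {u u' x : V} (h : x ≠ u) : collapse u u' x = x := if_neg h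

lemma shift_adj_elim {u u' v x y : V} (h : (G.shift u u' v).Adj x y) :
    (∃ p q, G.Adj p q ∧ collapse u u' p = x ∧ collapse u u' q = y) ∨
      (x = u ∧ y = v) ∨ (x = v ∧ y = u) := by
  obtain ⟨h | h, -⟩ := (fromEdgeSet_adj _).1 h
  · obtain ⟨e, he, hxy⟩ := h
    induction e with
    | _ p q =>
      rw [Sym2.map_mk, Sym2.eq_iff] at hxy
      rcases hxy with ⟨h1, h2⟩ | ⟨h1, h2⟩
      · exact Or.inl ⟨p, q, he, h1, h2⟩
      · exact Or.inl ⟨q, p, (show G.Adj p q from he).symm, h2, h1⟩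
  · exact Or.inr (Sym2.eq_iff.1 h)

lemma shift_adj_self {u u' v : V} (h : u ≠ v) : (G.shift u u' v).Adj u v :=
  (fromEdgeSet_adj _).2 ⟨Or.inr rfl, h⟩

lemma IsTree.not_adj_of_adj (hG : G.IsTree) {u u' v : V} (hu : G.Adj u v) (hu' : G.Adj u' v) :
    ¬ G.Adj u u' := by
  intro h
  have := hG.dist_ne_of_adj v h
  rw [dist_eq_one_iff_adj.2 hu.symm, dist_eq_one_iff_adj.2 hu'.symm] at this
  exact this rfl

lemma IsTree.shift_adj_collapse (hG : G.IsTree) {u u' v p q : V} (hu : G.Adj u v)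
    (hu' : G.Adj u' v) (h : G.Adj p q) :
    (G.shift u u' v).Adj (collapse u u' p) (collapse u u' q) := by
  refine (fromEdgeSet_adj _).2 ⟨Or.inl ⟨s(p, q), h, by simp⟩, ?_⟩
  have hnot := hG.not_adj_of_adj hu hu'
  by_cases hp : p = u <;> by_cases hq : q = u
  · exact absurd (hp.trans hq.symm) h.ne
  · subst hp
    rw [collapse_self, collapse_of_ne hq]
    rintro rfl
    exact hnot h
  · subst hq
    rw [collapse_self, collapse_of_ne hp]
    rintro rfl
    exact hnot h.symm
  · rw [collapse_of_ne hp, collapse_of_ne hq]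
    exact h.ne

lemma IsTree.shift_connected (hG : G.IsTree) {u u' v : V} (hu : G.Adj u v)
    (hu' : G.Adj u' v) : (G.shift u u' v).Connected := by
  have : Nonempty V := ⟨u⟩
  have key : ∀ x y, (G.shift u u' v).Reachable (collapse u u' x) (collapse u u' y) :=
    fun x y => (hG.connected x y).map
      (⟨collapse u u', fun h => hG.shift_adj_collapse hu hu' h⟩ : G →g G.shift u u' v)
  have hv : ∀ x, (G.shift u u' v).Reachable x v := by
    intro x
    by_cases hx : x = u
    · subst hx
      exact (shift_adj_self hu.ne).reachable
    · have := key x v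
      rwa [collapse_of_ne hx, collapse_of_ne hu.ne'] at this
  exact connected_iff _ |>.2 ⟨fun x y => (hv x).trans (hv y).symm, ⟨u⟩⟩

lemma IsTree.shift_isTree [Finite V] (hG : G.IsTree) {u u' v : V} (hu : G.Adj u v)
    (hu' : G.Adj u' v) (hne : u ≠ u') : (G.shift u u' v).IsTree := by
  have hconn := hG.shift_connected hu hu'
  refine isTree_iff_connected_and_card.2 ⟨hconn, le_antisymm ?_ ?_⟩
  · rw [← (isTree_iff_connected_and_card.1 hG).2]
    have hmem : s(u, v) ∈ G.edgeSet := hu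
    have hmap : Sym2.map (collapse u u') s(u, v) = Sym2.map (collapse u u') s(u', v) := by
      simp [collapse_self, collapse_of_ne hne.symm]
    have hsub : (G.shift u u' v).edgeSet ⊆
        insert s(u, v) (Sym2.map (collapse u u') '' (G.edgeSet \ {s(u, v)})) := by
      intro e he
      rw [shift, edgeSet_fromEdgeSet] at he
      obtain ⟨⟨d, hd, rfl⟩ | he, -⟩ := he
      · refine Or.inr ?_
        by_cases hd' : d = s(u, v)
        · subst hd'
          refine ⟨s(u', v), ⟨hu', ?_⟩, hmap.symm⟩
          simp only [Set.mem_singleton_iff, Sym2.eq_iff]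
          rintro (⟨h, -⟩ | ⟨h, -⟩)
          · exact hne h.symm
          · exact hu'.ne h
        · exact ⟨d, ⟨hd, hd'⟩, rfl⟩
      · exact Or.inl he
    have h1 := Set.ncard_le_ncard hsub (Set.toFinite _)
    have h2 := Set.ncard_insert_le s(u, v) (Sym2.map (collapse u u') '' (G.edgeSet \ {s(u, v)}))
    have h3 := Set.ncard_image_le (f := Sym2.map (collapse u u'))
      (Set.toFinite (G.edgeSet \ {s(u, v)}))
    have h4 := Set.ncard_sdiff_singleton_add_one hmem (Set.toFinite _)
    rw [Nat.card_coe_set_eq, Nat.card_coe_set_eq]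
    omega
  · exact hconn.card_vert_le_card_edgeSet_add_one

lemma IsTree.eq_of_adj_of_mem_branch (hG : G.IsTree) {u v p q : V} (hu : G.Adj u v)
    (h : G.Adj p q) (hp : p ∈ G.branch u v) (hq : q ∉ G.branch u v) : q = u := by
  by_contra hne
  have h1 := hG.dist_adj_cases_s16 q hu
  rw [mem_branch] at hp hq
  exact hp.2 (hG.eq_of_adj_of_sides hu h hp.1 (by by_contra; exact hq ⟨by omega, hne⟩)).1

lemma IsTree.eq_of_adj_of_notMem_branch (hG : G.IsTree) {u v q : V} (hu : G.Adj u v)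
    (h : G.Adj u q) (hq : q ∉ G.branch u v) : q = v := by
  have h1 := hG.dist_adj_cases_s16 q hu
  rw [mem_branch] at hq
  refine (hG.eq_of_adj_of_sides hu h ?_ ?_).2
  · rw [dist_self, dist_eq_one_iff_adj.2 hu]
    exact one_pos
  · by_contra
    exact hq ⟨by omega, h.ne'⟩

lemma retract_of_mem {B : Set V} {u x : V} (h : x ∈ B) : retract B u x = u := if_pos h

lemma retract_of_notMem {B : Set V} {u x : V} (h : x ∉ B) : retract B u x = x := if_neg h

lemma IsTree.shift_adj_retract (hG : G.IsTree) {u u' v p q : V} (hu : G.Adj u v)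
    (hu' : G.Adj u' v) (h : G.Adj p q) :
    retract (G.branch u v) u p = retract (G.branch u v) u q ∨
      (G.shift u u' v).Adj (retract (G.branch u v) u p) (retract (G.branch u v) u q) := by
  by_cases hp : p ∈ G.branch u v <;> by_cases hq : q ∈ G.branch u v
  · left; rw [retract_of_mem hp, retract_of_mem hq]
  · left; rw [retract_of_mem hp, retract_of_notMem hq, hG.eq_of_adj_of_mem_branch hu h hp hq]
  · left; rw [retract_of_mem hq, retract_of_notMem hp, hG.eq_of_adj_of_mem_branch hu h.symm hq hp]
  · right
    rw [retract_of_notMem hp, retract_of_notMem hq]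
    by_cases hpu : p = u
    · subst hpu
      rw [hG.eq_of_adj_of_notMem_branch hu h hq]
      exact shift_adj_self hu.ne
    by_cases hqu : q = u
    · subst hqu
      rw [hG.eq_of_adj_of_notMem_branch hu h.symm hp]
      exact (shift_adj_self hu.ne).symm
    have := hG.shift_adj_collapse hu hu' h
    rwa [collapse_of_ne hpu, collapse_of_ne hqu] at this

lemma notMem_branch_self {u v : V} : u ∉ G.branch u v := fun h => h.2 rfl

lemma notMem_branch_parent {u v : V} : v ∉ G.branch u v := fun h => by
  have := h.1
  simp at this

lemma IsTree.notMem_branch_sibling (hG : G.IsTree) {u u' v : V}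
    (hu' : G.Adj u' v) : u' ∉ G.branch u v := fun h => by
  have h1 := h.1
  have h2 := hG.connected.pos_dist_of_ne h.2
  rw [dist_eq_one_iff_adj.2 hu'] at h1
  omega

lemma IsTree.adj_retract_of_shift_adj (hG : G.IsTree) {u u' v x y : V} (hu : G.Adj u v)
    (hu' : G.Adj u' v) (h : (G.shift u u' v).Adj x y) :
    retract (G.branch u v) u' x = retract (G.branch u v) u' y ∨
      G.Adj (retract (G.branch u v) u' x) (retract (G.branch u v) u' y) := by
  have hu'B := hG.notMem_branch_sibling (u := u) hu'
  have hc : ∀ p, p ∉ G.branch u v → collapse u u' p ∉ G.branch u v := by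
    intro p hp
    by_cases hpu : p = u
    · rwa [hpu, collapse_self]
    · rwa [collapse_of_ne hpu]
  have hcB : ∀ p, p ∈ G.branch u v → collapse u u' p = p := fun p hp => collapse_of_ne hp.2
  rcases shift_adj_elim h with ⟨p, q, hpq, rfl, rfl⟩ | ⟨rfl, rfl⟩ | ⟨rfl, rfl⟩
  · by_cases hp : p ∈ G.branch u v <;> by_cases hq : q ∈ G.branch u v
    · left; rw [hcB p hp, hcB q hq, retract_of_mem hp, retract_of_mem hq]
    · left
      rw [hcB p hp, retract_of_mem hp, retract_of_notMem (hc q hq),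
        hG.eq_of_adj_of_mem_branch hu hpq hp hq, collapse_self]
    · left
      rw [hcB q hq, retract_of_mem hq, retract_of_notMem (hc p hp),
        hG.eq_of_adj_of_mem_branch hu hpq.symm hq hp, collapse_self]
    · right
      rw [retract_of_notMem (hc p hp), retract_of_notMem (hc q hq)]
      by_cases hpu : p = u
      · subst hpu
        rw [hG.eq_of_adj_of_notMem_branch hu hpq hq, collapse_self, collapse_of_ne hu.ne']
        exact hu'
      by_cases hqu : q = u
      · subst hqu
        rw [hG.eq_of_adj_of_notMem_branch hu hpq.symm hp, collapse_self, collapse_of_ne hu.ne']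
        exact hu'.symm
      rwa [collapse_of_ne hpu, collapse_of_ne hqu]
  · right
    rwa [retract_of_notMem notMem_branch_self, retract_of_notMem notMem_branch_parent]
  · right
    rw [retract_of_notMem notMem_branch_self, retract_of_notMem notMem_branch_parent]
    exact hu.symm

lemma IsTree.dist_shift_le (hG : G.IsTree) {u u' v x y : V} (hu : G.Adj u v)
    (hu' : G.Adj u' v) (hx : x ≠ u) (hy : y ≠ u) :
    (G.shift u u' v).dist x y ≤ G.dist x y := by
  have := (hG.shift_connected hu hu').dist_map_le hG.connected (g := collapse u u')
    (fun p q h => Or.inr (hG.shift_adj_collapse hu hu' h)) x y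
  rwa [collapse_of_ne hx, collapse_of_ne hy] at this

lemma IsTree.dist_shift_self_le (hG : G.IsTree) {u u' v y : V} (hu : G.Adj u v)
    (hu' : G.Adj u' v) (hy : y ≠ u) : (G.shift u u' v).dist y u ≤ G.dist y v + 1 := by
  have h1 := (hG.shift_connected hu hu').dist_triangle (u := y) (v := v) (w := u)
  have h2 := hG.dist_shift_le hu hu' hy hu.ne'
  rw [dist_eq_one_iff_adj.2 (shift_adj_self hu.ne).symm] at h1
  omega

lemma IsTree.dist_shift_eq (hG : G.IsTree) {u u' v a : V} (hu : G.Adj u v)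
    (hu' : G.Adj u' v) (ha : G.dist a v < G.dist a u) (ha' : G.dist a v < G.dist a u') (x : V) :
    (G.shift u u' v).dist x a = G.dist x a := by
  have hau : a ≠ u := by rintro rfl; simp at ha
  have h1 := hG.dist_adj_cases_s16 a hu
  have h2 := hG.dist_adj_cases_s16 a hu'
  apply le_antisymm
  · by_cases hx : x = u
    · subst hx
      have h3 := hG.dist_shift_self_le hu hu' hau
      rw [dist_comm, dist_comm (u := x)]
      omega
    · exact hG.dist_shift_le hu hu' hx hau
  · have hc : ∀ p, G.dist a (collapse u u' p) = G.dist a p := by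
      intro p
      by_cases hp : p = u
      · rw [hp, collapse_self]; omega
      · rw [collapse_of_ne hp]
    have := (hG.shift_connected hu hu').le_add_dist (f := fun z => G.dist a z) (by
      intro p q hpq
      rcases shift_adj_elim hpq with ⟨p, q, h, rfl, rfl⟩ | ⟨rfl, rfl⟩ | ⟨rfl, rfl⟩
      · simp only [hc]
        have := hG.dist_adj_cases_s16 a h
        omega
      · omega
      · omega) x a
    simpa [dist_comm (u := x)] using this

end SimpleGraph

lemma SimpleGraph.IsTree.ecc_eq_max [Fintype V] {G : SimpleGraph V} (hG : G.IsTree) {a b : V}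
    (hab : ∀ x y, G.dist x y ≤ G.dist a b) (x : V) :
    ecc G x = max (G.dist x a) (G.dist x b) :=
  le_antisymm (Finset.sup_le fun y _ => hG.dist_le_max_of_diametral hab x y)
    (max_le (Finset.le_sup (f := fun u => G.dist x u) (Finset.mem_univ a))
      (Finset.le_sup (f := fun u => G.dist x u) (Finset.mem_univ b)))

lemma ecc_shift [Fintype V] {G : SimpleGraph V} (hG : G.IsTree) {u u' v a b : V}
    (hu : G.Adj u v) (hu' : G.Adj u' v) (hne : u ≠ u')
    (hab : ∀ x y, G.dist x y ≤ G.dist a b)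
    (hau : G.dist a v < G.dist a u) (hau' : G.dist a v < G.dist a u')
    (hbu : G.dist b v < G.dist b u) (hle : G.dist b v ≤ G.dist a v) (x : V) :
    ecc (G.shift u u' v) x = ecc G x := by
  have hH := hG.shift_isTree hu hu' hne
  have hbne : b ≠ u := by rintro rfl; simp at hbu
  have hdist := hG.dist_shift_eq hu hu' hau hau'
  have hbH : (G.shift u u' v).dist a b = G.dist a b := by
    rw [SimpleGraph.dist_comm, hdist, SimpleGraph.dist_comm]
  have haux : ∀ y, y ≠ u → (G.shift u u' v).dist y u ≤ G.dist a b := by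
    intro y hy
    have h1 := hG.dist_shift_self_le hu hu' hy
    have h2 := hG.dist_adj_cases_s16 y hu
    have h3 := hG.dist_adj_cases_s16 y hu'
    have h4 := hab y u
    have h5 := hab y u'
    by_contra hcon
    exact hne (hG.eq_of_adj_of_dist_lt_s16 (r := y) hu.symm hu'.symm (by omega) (by omega))
  have habH : ∀ x y, (G.shift u u' v).dist x y ≤ (G.shift u u' v).dist a b := by
    intro x y
    rw [hbH]
    by_cases hx : x = u <;> by_cases hy : y = u
    · rw [hx, hy, SimpleGraph.dist_self]; exact Nat.zero_le _
    · rw [hx, SimpleGraph.dist_comm]; exact haux y hy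
    · rw [hy]; exact haux x hx
    · exact (hG.dist_shift_le hu hu' hx hy).trans (hab x y)
  rw [hH.ecc_eq_max habH, hG.ecc_eq_max hab, hdist]
  have hup : (G.shift u u' v).dist x b ≤ G.dist x b := by
    by_cases hx : x = u
    · subst hx
      have h1 := hG.dist_shift_self_le hu hu' hbne
      rw [SimpleGraph.dist_comm, SimpleGraph.dist_comm (u := x)]
      omega
    · exact hG.dist_shift_le hu hu' hx hbne
  by_cases hx : x ∈ G.branch u v
  · have h1 := hG.dist_of_sides hu hx.1 hau
    have h2 := hG.dist_of_sides hu hx.1 hbu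
    rw [SimpleGraph.dist_comm (u := v)] at h1 h2
    omega
  · have hb : b ∉ G.branch u v := fun h => by
      have := h.1
      omega
    have h1 := hG.connected.dist_map_le hH.connected
      (fun p q => hG.adj_retract_of_shift_adj hu hu') x b
    rw [SimpleGraph.retract_of_notMem hx, SimpleGraph.retract_of_notMem hb] at h1
    omega

lemma steinerDist_add_one_le [Fintype V] {G : SimpleGraph V} {A S : Finset V} (hAS : A ⊆ S)
    (hS : (G.induce (S : Set V)).Connected) : steinerDist G A + 1 ≤ #S := by
  obtain ⟨⟨s, hs⟩⟩ := hS.nonempty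
  have hpos : 0 < #S := Finset.card_pos.2 ⟨s, hs⟩
  have : steinerDist G A ≤ #S - 1 := Nat.sInf_le ⟨S, hAS, hS, by omega⟩
  omega

lemma exists_card_eq_steinerDist_add_one [Fintype V] {G : SimpleGraph V} (hG : G.Connected)
    (A : Finset V) : ∃ S : Finset V, A ⊆ S ∧ (G.induce (S : Set V)).Connected ∧
      #S = steinerDist G A + 1 := by
  refine Nat.sInf_mem (s := {m | ∃ S : Finset V, A ⊆ S ∧
    (G.induce (S : Set V)).Connected ∧ #S = m + 1}) ⟨#(Finset.univ : Finset V) - 1,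
    Finset.univ, Finset.subset_univ A, ?_, ?_⟩
  · rw [Finset.coe_univ]
    exact (SimpleGraph.induceUnivIso G).symm.connected_iff.1 hG
  · have := hG.nonempty
    have : 0 < #(Finset.univ : Finset V) := Finset.card_pos.2 Finset.univ_nonempty
    omega

/-- Swap `u` and `u'` in the sets that meet `B`. -/
noncomputable def swapOn (B : Set V) (u u' : V) (A : Finset V) : Finset V :=
  if ∃ x ∈ A, x ∈ B then A.map (Equiv.swap u u').toEmbedding else A

lemma swapOn_card (B : Set V) (u u' : V) (A : Finset V) : #(swapOn B u u' A) = #A := by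
  rw [swapOn]
  split_ifs <;> simp

lemma swapOn_swapOn {B : Set V} {u u' : V} (hu : u ∉ B) (hu' : u' ∉ B) (A : Finset V) :
    swapOn B u u' (swapOn B u u' A) = A := by
  by_cases h : ∃ x ∈ A, x ∈ B
  · have h' : ∃ x ∈ A.map (Equiv.swap u u').toEmbedding, x ∈ B := by
      obtain ⟨x, hxA, hxB⟩ := h
      refine ⟨x, Finset.mem_map.2 ⟨x, hxA, ?_⟩, hxB⟩
      exact Equiv.swap_apply_of_ne_of_ne (by rintro rfl; exact hu hxB)
        (by rintro rfl; exact hu' hxB)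
    rw [swapOn, swapOn, if_pos h, if_pos h', Finset.map_map]
    ext x
    simp
  · rw [swapOn, swapOn, if_neg h, if_neg h]

lemma map_swap_subset {u u' : V} {A T : Finset V} (hT : ∀ x ∈ A, x ≠ u → x ≠ u' → x ∈ T)
    (hu : u' ∈ A → u ∈ T) (hu' : u ∈ A → u' ∈ T) :
    A.map (Equiv.swap u u').toEmbedding ⊆ T := by
  intro x hx
  obtain ⟨y, hy, rfl⟩ := Finset.mem_map.1 hx
  by_cases h1 : y = u
  · subst h1; simpa using hu' hy
  by_cases h2 : y = u'
  · subst h2; simpa using hu hy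
  simpa [Equiv.swap_apply_of_ne_of_ne h1 h2] using hT y hy h1 h2

lemma mem_image_collapse {u u' x : V} {S : Finset V} (hx : x ∈ S) (hne : x ≠ u) :
    x ∈ S.image (SimpleGraph.collapse u u') :=
  Finset.mem_image.2 ⟨x, hx, SimpleGraph.collapse_of_ne hne⟩

lemma card_image_collapse_lt {u u' : V} {S : Finset V} (hne : u ≠ u') (hu : u ∈ S)
    (hu' : u' ∈ S) : #(S.image (SimpleGraph.collapse u u')) < #S := by
  refine lt_of_le_of_ne Finset.card_image_le fun h => ?_
  refine hne (Finset.card_image_iff.1 h hu hu' ?_)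
  rw [SimpleGraph.collapse_self, SimpleGraph.collapse_of_ne hne.symm]

section SteinerShift

variable {G : SimpleGraph V} {u u' v : V}

lemma SimpleGraph.IsTree.sibling_side (hG : G.IsTree) (hu : G.Adj u v) (hu' : G.Adj u' v)
    (hne : u ≠ u') : G.dist u' v < G.dist u' u := by
  have h1 := hG.dist_adj_cases_s16 u' hu
  rw [dist_eq_one_iff_adj.2 hu'] at h1 ⊢
  have := hG.connected.pos_dist_of_ne hne.symm
  omega

lemma steinerDist_shift_le [Fintype V] (hG : G.IsTree) (hu : G.Adj u v) (hu' : G.Adj u' v)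
    (hne : u ≠ u') (A : Finset V) :
    steinerDist (G.shift u u' v) (swapOn (G.branch u v) u u' A) ≤ steinerDist G A := by
  obtain ⟨S, hAS, hS, hcard⟩ := exists_card_eq_steinerDist_add_one hG.connected A
  have hcol : ((G.shift u u' v).induce
      (S.image (SimpleGraph.collapse u u') : Set V)).Connected :=
    SimpleGraph.induce_image_connected hS
      fun p q h => Or.inr (hG.shift_adj_collapse hu hu' h)
  rw [swapOn]
  split_ifs with hB
  · obtain ⟨w, hwA, hwB⟩ := hB
    by_cases hu'A : u' ∈ A
    · obtain ⟨huS, hvS⟩ := hG.mem_of_induce_connected hu hS (hAS hwA) (hAS hu'A) hwB.1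
        (hG.sibling_side hu hu' hne)
      have hlt := card_image_collapse_lt hne huS (hAS hu'A)
      have h := steinerDist_add_one_le (A := A.map (Equiv.swap u u').toEmbedding)
        (map_swap_subset
          (fun x hx h1 _ => Finset.mem_insert_of_mem (mem_image_collapse (hAS hx) h1))
          (fun _ => Finset.mem_insert_self u _)
          (fun _ => Finset.mem_insert_of_mem (mem_image_collapse (hAS hu'A) hne.symm)))
        (SimpleGraph.induce_insert_connected hcol (mem_image_collapse hvS hu.ne')
          (SimpleGraph.shift_adj_self hu.ne))
      have := Finset.card_insert_le u (S.image (SimpleGraph.collapse u u'))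
      omega
    · have h := steinerDist_add_one_le (A := A.map (Equiv.swap u u').toEmbedding)
        (map_swap_subset (fun x hx h1 _ => mem_image_collapse (hAS hx) h1)
          (fun h => absurd h hu'A)
          (fun h => Finset.mem_image.2 ⟨u, hAS h, SimpleGraph.collapse_self u u'⟩)) hcol
      have := Finset.card_image_le (s := S) (f := SimpleGraph.collapse u u')
      omega
  · have h := steinerDist_add_one_le (A := A)
      (S := S.image (SimpleGraph.retract (G.branch u v) u))
      (fun x hx => Finset.mem_image.2 ⟨x, hAS hx,
        SimpleGraph.retract_of_notMem fun h => hB ⟨x, hx, h⟩⟩)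
      (SimpleGraph.induce_image_connected (g := SimpleGraph.retract (G.branch u v) u) hS
        fun p q h => hG.shift_adj_retract hu hu' h)
    have := Finset.card_image_le (s := S) (f := SimpleGraph.retract (G.branch u v) u)
    omega

lemma steinerDist_shift_lt [Fintype V] (hG : G.IsTree) (hu : G.Adj u v) (hu' : G.Adj u' v)
    (hne : u ≠ u') {A : Finset V} {w w' : V} (hw : w ∈ A) (hwB : w ∈ G.branch u v)
    (hw' : w' ∈ A) (hwB' : w' ∈ G.branch u' v) (hw'u : G.dist w' v < G.dist w' u)
    (hwu' : G.dist w v < G.dist w u') (hA : u' ∉ A) :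
    steinerDist (G.shift u u' v) (swapOn (G.branch u v) u u' A) < steinerDist G A := by
  obtain ⟨S, hAS, hS, hcard⟩ := exists_card_eq_steinerDist_add_one hG.connected A
  have hcol : ((G.shift u u' v).induce
      (S.image (SimpleGraph.collapse u u') : Set V)).Connected :=
    SimpleGraph.induce_image_connected hS
      fun p q h => Or.inr (hG.shift_adj_collapse hu hu' h)
  have huS := (hG.mem_of_induce_connected hu hS (hAS hw) (hAS hw') hwB.1 hw'u).1
  have huS' := (hG.mem_of_induce_connected hu' hS (hAS hw') (hAS hw) hwB'.1 hwu').1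
  rw [swapOn, if_pos ⟨w, hw, hwB⟩]
  have h := steinerDist_add_one_le (A := A.map (Equiv.swap u u').toEmbedding)
    (map_swap_subset (fun x hx h1 _ => mem_image_collapse (hAS hx) h1)
      (fun h => absurd h hA)
      (fun _ => mem_image_collapse huS' hne.symm)) hcol
  have := card_image_collapse_lt hne huS huS'
  omega

lemma steinerWiener_shift_lt [Fintype V] (hG : G.IsTree) (hu : G.Adj u v) (hu' : G.Adj u' v)
    (hne : u ≠ u') {w w' : V} (hw : G.Adj u w) (hwv : w ≠ v) (hw' : G.Adj u' w') (hwv' : w' ≠ v)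
    {k : ℕ} (hk1 : 2 ≤ k) (hk2 : k ≤ Fintype.card V - 1) :
    steinerWiener (G.shift u u' v) k < steinerWiener G k := by
  have hbr : ∀ {p q : V}, G.Adj p v → G.Adj p q → q ≠ v → q ∈ G.branch p v := by
    intro p q hp hpq hqv
    by_contra hcon
    exact hqv (hG.eq_of_adj_of_notMem_branch hp hpq hcon)
  have hwB := hbr hu hw hwv
  have hwB' := hbr hu' hw' hwv'
  have hside : ∀ {p p' q : V}, G.Adj p v → G.Adj p' v → p ≠ p' → q ∈ G.branch p v →
      G.dist q v < G.dist q p' := by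
    intro p p' q hp hp' hpp hq
    have h1 := hG.dist_adj_cases_s16 q hp'
    by_contra hcon
    exact hpp (hG.eq_of_adj_of_dist_lt_s16 (r := q) hp.symm hp'.symm hq.1 (by omega))
  have hwu' := hside hu hu' hne hwB
  have hw'u := hside hu' hu hne.symm hwB'
  have hww' : w ≠ w' := by
    rintro rfl
    have := hwB.1
    omega
  obtain ⟨A, hA1, hA2, hA3⟩ := Finset.exists_subsuperset_card_eq
    (s := {w, w'}) (t := Finset.univ.erase u') (n := k)
    (by
      intro x hx
      rcases Finset.mem_insert.1 hx with rfl | hx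
      · refine Finset.mem_erase.2 ⟨?_, Finset.mem_univ _⟩
        rintro rfl
        simp at hwu'
      · rw [Finset.mem_singleton.1 hx]
        exact Finset.mem_erase.2 ⟨hw'.ne', Finset.mem_univ _⟩)
    (by rwa [Finset.card_pair hww'])
    (by rwa [Finset.card_erase_of_mem (Finset.mem_univ _), Finset.card_univ])
  have hB := SimpleGraph.notMem_branch_self (G := G) (u := u) (v := v)
  have hB' := hG.notMem_branch_sibling (u := u) hu'
  have hmem : ∀ C ∈ Finset.univ.powersetCard k,
      swapOn (G.branch u v) u u' C ∈ (Finset.univ : Finset V).powersetCard k := by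
    intro C hC
    rw [Finset.mem_powersetCard_univ] at hC ⊢
    rw [swapOn_card, hC]
  calc steinerWiener (G.shift u u' v) k
      = ∑ C ∈ Finset.univ.powersetCard k,
          steinerDist (G.shift u u' v) (swapOn (G.branch u v) u u' C) := by
        refine (Finset.sum_nbij' (swapOn (G.branch u v) u u') (swapOn (G.branch u v) u u')
          hmem hmem ?_ ?_ ?_)
        · exact fun C _ => swapOn_swapOn hB hB' C
        · exact fun C _ => swapOn_swapOn hB hB' C
        · exact fun C _ => by rw [swapOn_swapOn hB hB' C]
    _ < steinerWiener G k := by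
        refine Finset.sum_lt_sum (fun C _ => steinerDist_shift_le hG hu hu' hne C)
          ⟨A, Finset.mem_powersetCard_univ.2 hA3, ?_⟩
        exact steinerDist_shift_lt hG hu hu' hne (hA1 (by simp)) hwB (hA1 (by simp)) hwB' hw'u hwu'
          fun h => (Finset.mem_erase.1 (hA2 h)).1 rfl

end SteinerShift

lemma exists_adj_ne_of_not_isLeaf {G : SimpleGraph V} {u v : V} (hu : ¬ IsLeaf G u)
    (huv : G.Adj u v) : ∃ w, G.Adj u w ∧ w ≠ v := by
  by_contra! hcon
  refine hu (Nat.card_eq_one_iff_unique.2 ⟨⟨?_⟩, ⟨⟨v, huv⟩⟩⟩)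
  rintro ⟨x, hx⟩ ⟨y, hy⟩
  exact Subtype.ext ((hcon x hx).trans (hcon y hy).symm)

lemma not_isLeaf_of_adj_of_adj {G : SimpleGraph V} {u v w : V} (hv : G.Adj u v)
    (hw : G.Adj u w) (hne : v ≠ w) : ¬ IsLeaf G u := fun h => by
  have := (Nat.card_eq_one_iff_unique.1 h).1
  exact hne (congrArg Subtype.val (Subsingleton.elim (⟨v, hv⟩ : {x // G.Adj u x}) ⟨w, hw⟩))

/-- A tree is a caterpillar if its non-leaves all lie on one path. -/
lemma isCaterpillar_of_dist_add_dist [Finite V] {G : SimpleGraph V} (hG : G.IsTree) {a b : V}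
    (h : ∀ t, ¬ IsLeaf G t → G.dist a t + G.dist b t = G.dist a b) : IsCaterpillar G := by
  intro z hz
  have hinj : Function.Injective
      fun t : {u : V // G.Adj z u ∧ ¬ IsLeaf G u} => decide (G.dist a t < G.dist a z) := by
    rintro ⟨x, hx, hxl⟩ ⟨y, hy, hyl⟩ hxy
    have h1 := h z hz
    have h2 := h x hxl
    have h3 := h y hyl
    have h4 := hG.dist_adj_cases_s16 a hx
    have h5 := hG.dist_adj_cases_s16 a hy
    simp only [decide_eq_decide] at hxy
    refine Subtype.ext ?_
    by_cases hlt : G.dist a x < G.dist a z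
    · exact hG.eq_of_adj_of_dist_lt_s16 hx hy hlt (hxy.1 hlt)
    · have hlt' := fun hy' => hlt (hxy.2 hy')
      exact hG.eq_of_adj_of_dist_lt_s16 (r := b) hx hy
        (show G.dist b x < G.dist b z by omega) (show G.dist b y < G.dist b z by omega)
  simpa using Nat.card_le_card_of_injective _ hinj

/-- If the non-leaves of a tree do not all lie on the geodesic from `a` to `b`, one of those off
it is adjacent to a vertex on it. -/
lemma exists_not_isLeaf_adj_geodesic [Fintype V] {G : SimpleGraph V} (hG : G.IsTree) {a b t : V}
    (ht : ¬ IsLeaf G t) (hoff : G.dist a t + G.dist b t ≠ G.dist a b) :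
    ∃ u v, ¬ IsLeaf G u ∧ G.Adj u v ∧ G.dist a v + G.dist b v = G.dist a b ∧
      G.dist a u = G.dist a v + 1 ∧ G.dist b u = G.dist b v + 1 := by
  obtain ⟨u, hu, hmin⟩ := Finset.exists_min_image
    (Finset.univ.filter fun x => ¬ IsLeaf G x ∧ G.dist a x + G.dist b x ≠ G.dist a b)
    (fun x => G.dist a x + G.dist b x) ⟨t, by simp [ht, hoff]⟩
  obtain ⟨-, hul, huoff⟩ := Finset.mem_filter.1 hu
  have hua : u ≠ a := by
    rintro rfl
    simp [SimpleGraph.dist_comm] at huoff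
  obtain ⟨v, huv, hav⟩ := hG.connected.exists_adj_dist_add_one hua
  have hbv : G.dist b u = G.dist b v + 1 := by
    have h1 := hG.dist_adj_cases_s16 b huv
    by_contra hcon
    have h2 := hG.dist_of_sides (x := a) (y := b) huv.symm (by omega) (by omega)
    rw [SimpleGraph.dist_comm (u := u)] at h2
    omega
  refine ⟨u, v, hul, huv, ?_, hav, hbv⟩
  by_contra hvoff
  have hva : v ≠ a := by
    rintro rfl
    simp [SimpleGraph.dist_comm] at hvoff
  obtain ⟨y, hvy, hay⟩ := hG.connected.exists_adj_dist_add_one hva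
  have hvl := not_isLeaf_of_adj_of_adj huv.symm hvy (by rintro rfl; omega)
  have := hmin v (Finset.mem_filter.2 ⟨Finset.mem_univ v, hvl, hvoff⟩)
  omega

lemma exists_steinerWiener_lt_of_adj [Fintype V] {G : SimpleGraph V} (hG : G.IsTree) {k : ℕ}
    (hk1 : 2 ≤ k) (hk2 : k ≤ Fintype.card V - 1) {a b u v : V}
    (hab : ∀ x y, G.dist x y ≤ G.dist a b) (hul : ¬ IsLeaf G u) (huv : G.Adj u v)
    (hv : G.dist a v + G.dist b v = G.dist a b) (hau : G.dist a u = G.dist a v + 1)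
    (hbu : G.dist b u = G.dist b v + 1) (hle : G.dist b v ≤ G.dist a v) :
    ∃ H : SimpleGraph V, H.IsTree ∧ (∀ x, ecc H x = ecc G x) ∧
      steinerWiener H k < steinerWiener G k := by
  obtain ⟨w, huw, hwv⟩ := exists_adj_ne_of_not_isLeaf hul huv
  have haw : G.dist a w = G.dist a u + 1 := by
    rcases hG.dist_adj_cases_s16 a huw with h | h
    · exact absurd (hG.eq_of_adj_of_dist_lt_s16 (r := a) huw huv (by omega) (by omega)) hwv
    · exact h
  have h1 := hab a w
  have hvb : v ≠ b := by
    rintro rfl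
    rw [SimpleGraph.dist_self] at hv
    omega
  obtain ⟨u', hvu', hbu'⟩ := hG.connected.exists_adj_dist_add_one hvb
  have hu'b : u' ≠ b := by
    rintro rfl
    rw [SimpleGraph.dist_self] at hbu'
    omega
  obtain ⟨w', huw', hbw'⟩ := hG.connected.exists_adj_dist_add_one hu'b
  have h2 := hG.connected.dist_triangle (u := a) (v := u') (w := b)
  rw [SimpleGraph.dist_comm (u := u')] at h2
  have hne : u ≠ u' := by rintro rfl; omega
  exact ⟨G.shift u u' v, hG.shift_isTree huv hvu'.symm hne,
    ecc_shift hG huv hvu'.symm hne hab (by omega) (by omega) (by omega) hle,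
    steinerWiener_shift_lt hG huv hvu'.symm hne huw hwv huw' (by rintro rfl; omega) hk1 hk2⟩

lemma exists_steinerWiener_lt [Fintype V] {G : SimpleGraph V} (hG : G.IsTree) {k : ℕ}
    (hk1 : 2 ≤ k) (hk2 : k ≤ Fintype.card V - 1) (hcat : ¬ IsCaterpillar G) :
    ∃ H : SimpleGraph V, H.IsTree ∧ (∀ x, ecc H x = ecc G x) ∧
      steinerWiener H k < steinerWiener G k := by
  have := hG.connected.nonempty
  obtain ⟨⟨a, b⟩, hab⟩ := Finite.exists_max fun p : V × V => G.dist p.1 p.2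
  replace hab : ∀ x y, G.dist x y ≤ G.dist a b := fun x y => hab (x, y)
  obtain ⟨t, ht, hoff⟩ : ∃ t, ¬ IsLeaf G t ∧ G.dist a t + G.dist b t ≠ G.dist a b := by
    by_contra! h
    exact hcat (isCaterpillar_of_dist_add_dist hG h)
  obtain ⟨u, v, hul, huv, hv, hau, hbu⟩ := exists_not_isLeaf_adj_geodesic hG ht hoff
  rcases le_total (G.dist b v) (G.dist a v) with hle | hle
  · exact exists_steinerWiener_lt_of_adj hG hk1 hk2 hab hul huv hv hau hbu hle
  · refine exists_steinerWiener_lt_of_adj hG hk1 hk2 (a := b) (b := a) ?_ hul huv ?_ hbu hau hle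
    · rwa [SimpleGraph.dist_comm (u := b)]
    · rw [SimpleGraph.dist_comm (u := b) (v := a)]
      omega

/-- For `k ∈ {2,…,n-1}`, any tree minimising the `k`-Steiner Wiener index among all
trees with its eccentric sequence is a caterpillar. -/
theorem stmt16 [Fintype V] (G : SimpleGraph V) (hG : G.IsTree) (k : ℕ)
    (hk1 : 2 ≤ k) (hk2 : k ≤ Fintype.card V - 1)
    (hmin : ∀ H : SimpleGraph V, H.IsTree → sameEccSeq G H →
      steinerWiener G k ≤ steinerWiener H k) :
    IsCaterpillar G := by
  by_contra hcat
  obtain ⟨H, hH, hecc, hlt⟩ := exists_steinerWiener_lt hG hk1 hk2 hcat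
  exact (hmin H hH fun m => by simp only [hecc]).not_gt hlt
end
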